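/- (Observability inequality for boundary control in velocity, large time.) Assume that the complex numbers ν_n^h, ν_n^p (n ranging over the nonzero integers) are pairwise distinct, and let T > 2π/ū. Then there exists a constant C > 0 such that for all finitely supported families (a_n) and (c_n) of complex numbers indexed by the nonzero integers, Σ_n |a_n|²/n² + Σ_n |c_n|² e^{2Re(ν_n^p)T} ≤ C·∫₀ᵀ | Σ_n a_n·ν₂ⁿ(ν₂ⁿ−ū)·e^{ν_n^h(T−t)} + Σ_n c_n·ν₁ⁿ·e^{ν_n^p(T−t)} |² dt. (This is the observability inequality, written in the Riesz basis of eigenfunctions of the adjoint operator, that characterizes null controllability at time T of the linearized barotropic system in Ḣ¹_per(0,2π) × L̇²(0,2π) by one boundary control acting in the velocity.) -/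

import Mathlib

open scoped Classical
open Complex

/-- The hyperbolic branch of eigenvalues of the adjoint operator of the linearized
barotropic compressible Navier–Stokes system. -/
noncomputable def nuH (ρ u b μ : ℝ) (n : ℤ) : ℂ :=
  if 4 * b * ρ ≤ μ ^ 2 * (n : ℝ) ^ 2 then
    (((-(μ * (n : ℝ) ^ 2) + |(n : ℝ)| * Real.sqrt (μ ^ 2 * (n : ℝ) ^ 2 - 4 * b * ρ)) / 2 : ℝ) : ℂ)
      + Complex.I * ((u * (n : ℝ) : ℝ) : ℂ)
  else
    ((-(μ * (n : ℝ) ^ 2) / 2 : ℝ) : ℂ)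
      + Complex.I * ((u * (n : ℝ) + (n : ℝ) / 2 * Real.sqrt (4 * b * ρ - μ ^ 2 * (n : ℝ) ^ 2) : ℝ) : ℂ)

/-- The parabolic branch of eigenvalues. -/
noncomputable def nuP (ρ u b μ : ℝ) (n : ℤ) : ℂ :=
  if 4 * b * ρ ≤ μ ^ 2 * (n : ℝ) ^ 2 then
    (((-(μ * (n : ℝ) ^ 2) - |(n : ℝ)| * Real.sqrt (μ ^ 2 * (n : ℝ) ^ 2 - 4 * b * ρ)) / 2 : ℝ) : ℂ)
      + Complex.I * ((u * (n : ℝ) : ℝ) : ℂ)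
  else
    ((-(μ * (n : ℝ) ^ 2) / 2 : ℝ) : ℂ)
      + Complex.I * ((u * (n : ℝ) - (n : ℝ) / 2 * Real.sqrt (4 * b * ρ - μ ^ 2 * (n : ℝ) ^ 2) : ℝ) : ℂ)

/-- `ν₁ⁿ := ν_n^p / (i n)`. -/
noncomputable def nu1 (ρ u b μ : ℝ) (n : ℤ) : ℂ := nuP ρ u b μ n / (Complex.I * (n : ℂ))

/-- `ν₂ⁿ := ν_n^h / (i n)`. -/
noncomputable def nu2 (ρ u b μ : ℝ) (n : ℤ) : ℂ := nuH ρ u b μ n / (Complex.I * (n : ℂ))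

/-- The exponential sum `∑ i ∈ S, x i * exp (z i * s)`. -/
noncomputable def expSum {ι : Type*} (z : ι → ℂ) (S : Finset ι) (x : ι → ℂ) (s : ℝ) : ℂ :=
  ∑ i ∈ S, x i * Complex.exp (z i * s)

theorem continuous_expSum {ι : Type*} (z : ι → ℂ) (S : Finset ι) (x : ι → ℂ) :
    Continuous (expSum z S x) := by
  unfold expSum
  fun_prop

theorem expSum_add_sub {ι : Type*} (z : ι → ℂ) (S : Finset ι) (x : ι → ℂ) (s h : ℝ) (c : ℂ) :
    expSum z S x (s + h) - c * expSum z S x s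
      = expSum z S (fun i => x i * (Complex.exp (z i * h) - c)) s := by
  simp only [expSum, Finset.mul_sum, ← Finset.sum_sub_distrib]
  refine Finset.sum_congr rfl fun i _ => ?_
  push_cast
  rw [mul_add, Complex.exp_add]
  ring

theorem integral_norm_sq_mono {f : ℝ → ℂ} (hf : Continuous f) {a b c d : ℝ} (hca : c ≤ a)
    (hab : a ≤ b) (hbd : b ≤ d) :
    ∫ s in a..b, ‖f s‖ ^ 2 ≤ ∫ s in c..d, ‖f s‖ ^ 2 := by
  refine intervalIntegral.integral_mono_interval hca hab hbd ?_ ?_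
  · exact Filter.Eventually.of_forall fun s => by positivity
  · exact Continuous.intervalIntegrable (by fun_prop) _ _

theorem integral_norm_sq_nonneg (f : ℝ → ℂ) {a b : ℝ} (hab : a ≤ b) :
    0 ≤ ∫ s in a..b, ‖f s‖ ^ 2 :=
  intervalIntegral.integral_nonneg hab fun s _ => by positivity

theorem integral_norm_shift_sub_le {f : ℝ → ℂ} (hf : Continuous f) {τ h : ℝ} (hτ : 0 ≤ τ)
    (hh : 0 ≤ h) (c : ℂ) :
    ∫ s in (0 : ℝ)..τ, ‖f (s + h) - c * f s‖ ^ 2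
      ≤ (1 + ‖c‖) ^ 2 * ∫ s in (0 : ℝ)..(τ + h), ‖f s‖ ^ 2 := by
  have h1 : ∫ s in (0 : ℝ)..τ, ‖f (s + h)‖ ^ 2 ≤ ∫ s in (0 : ℝ)..(τ + h), ‖f s‖ ^ 2 := by
    rw [intervalIntegral.integral_comp_add_right (fun s => ‖f s‖ ^ 2) h]
    exact integral_norm_sq_mono hf (by linarith) (by linarith) le_rfl
  have h2 : ∫ s in (0 : ℝ)..τ, ‖f s‖ ^ 2 ≤ ∫ s in (0 : ℝ)..(τ + h), ‖f s‖ ^ 2 :=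
    integral_norm_sq_mono hf le_rfl hτ (by linarith)
  calc ∫ s in (0 : ℝ)..τ, ‖f (s + h) - c * f s‖ ^ 2
      ≤ ∫ s in (0 : ℝ)..τ, (1 + ‖c‖) * (‖f (s + h)‖ ^ 2 + ‖c‖ * ‖f s‖ ^ 2) := by
        refine intervalIntegral.integral_mono_on hτ
          (Continuous.intervalIntegrable (by fun_prop) _ _)
          (Continuous.intervalIntegrable (by fun_prop) _ _) fun s _ => ?_
        have h3 : ‖f (s + h) - c * f s‖ ≤ ‖f (s + h)‖ + ‖c‖ * ‖f s‖ := by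
          simpa using norm_sub_le (f (s + h)) (c * f s)
        calc ‖f (s + h) - c * f s‖ ^ 2 ≤ (‖f (s + h)‖ + ‖c‖ * ‖f s‖) ^ 2 := by gcongr
          _ ≤ _ := by
            nlinarith [mul_nonneg (norm_nonneg c) (sq_nonneg (‖f (s + h)‖ - ‖f s‖))]
    _ = (1 + ‖c‖) * ((∫ s in (0 : ℝ)..τ, ‖f (s + h)‖ ^ 2)
          + ‖c‖ * ∫ s in (0 : ℝ)..τ, ‖f s‖ ^ 2) := by
        rw [intervalIntegral.integral_const_mul, intervalIntegral.integral_add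
          (Continuous.intervalIntegrable (by fun_prop) _ _)
          (Continuous.intervalIntegrable (by fun_prop) _ _), intervalIntegral.integral_const_mul]
    _ ≤ (1 + ‖c‖) * ((∫ s in (0 : ℝ)..(τ + h), ‖f s‖ ^ 2)
          + ‖c‖ * ∫ s in (0 : ℝ)..(τ + h), ‖f s‖ ^ 2) := by gcongr
    _ = _ := by ring

theorem integral_norm_add_sq_le {f g : ℝ → ℂ} (hf : Continuous f) (hg : Continuous g) {a b : ℝ}
    (hab : a ≤ b) :
    ∫ s in a..b, ‖f s + g s‖ ^ 2
      ≤ 2 * (∫ s in a..b, ‖f s‖ ^ 2) + 2 * ∫ s in a..b, ‖g s‖ ^ 2 := by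
  rw [← intervalIntegral.integral_const_mul, ← intervalIntegral.integral_const_mul,
    ← intervalIntegral.integral_add (Continuous.intervalIntegrable (by fun_prop) _ _)
      (Continuous.intervalIntegrable (by fun_prop) _ _)]
  refine intervalIntegral.integral_mono_on hab (Continuous.intervalIntegrable (by fun_prop) _ _)
    (Continuous.intervalIntegrable (by fun_prop) _ _) fun s _ => ?_
  calc ‖f s + g s‖ ^ 2 ≤ (‖f s‖ + ‖g s‖) ^ 2 := by gcongr; exact norm_add_le _ _
    _ ≤ _ := by nlinarith [sq_nonneg (‖f s‖ - ‖g s‖)]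

theorem integral_norm_expSum_prod_le {ι : Type*} (z : ι → ℂ) (S J : Finset ι) (h : ι → ℝ)
    (hh : ∀ j, 0 ≤ h j) (x : ι → ℂ) {τ : ℝ} (hτ : 0 ≤ τ) :
    ∫ s in (0 : ℝ)..τ, ‖expSum z S
        (fun i => x i * ∏ j ∈ J, (Complex.exp (z i * h j) - Complex.exp (z j * h j))) s‖ ^ 2
      ≤ (∏ j ∈ J, (1 + ‖Complex.exp (z j * h j)‖)) ^ 2
        * ∫ s in (0 : ℝ)..(τ + ∑ j ∈ J, h j), ‖expSum z S x s‖ ^ 2 := by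
  induction J using Finset.induction_on generalizing τ with
  | empty => simp
  | insert j J hj ih =>
    have h1 := integral_norm_shift_sub_le (continuous_expSum z S
      (fun i => x i * ∏ j ∈ J, (Complex.exp (z i * h j) - Complex.exp (z j * h j)))) hτ (hh j)
      (Complex.exp (z j * h j))
    simp only [expSum_add_sub] at h1
    have h2 := ih (τ := τ + h j) (by linarith [hh j])
    rw [Finset.prod_insert hj, Finset.sum_insert hj, ← add_assoc]
    calc _ = _ := ?_
      _ ≤ _ := h1
      _ ≤ _ := mul_le_mul_of_nonneg_left h2 (by positivity)
      _ = _ := by ring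
    congr 1
    ext s
    congr 3
    ext i
    rw [Finset.prod_insert hj]
    ring

/-- Shifts eliminate every mode of an exponential sum except the `k`-th one. -/
theorem coeff_bound_of_shifts {ι : Type*} [DecidableEq ι] (z : ι → ℂ) (S : Finset ι) (h : ι → ℝ)
    (hh : ∀ j, 0 ≤ h j) (x : ι → ℂ) {τ : ℝ} (hτ : 0 ≤ τ) {k : ι} (hk : k ∈ S) :
    ‖x k‖ ^ 2 * (∏ j ∈ S.erase k, ‖Complex.exp (z k * h j) - Complex.exp (z j * h j)‖) ^ 2
        * ∫ s in (0 : ℝ)..τ, ‖Complex.exp (z k * s)‖ ^ 2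
      ≤ (∏ j ∈ S.erase k, (1 + ‖Complex.exp (z j * h j)‖)) ^ 2
        * ∫ s in (0 : ℝ)..(τ + ∑ j ∈ S.erase k, h j), ‖expSum z S x s‖ ^ 2 := by
  refine le_trans (le_of_eq ?_) (integral_norm_expSum_prod_le z S (S.erase k) h hh x hτ)
  rw [← intervalIntegral.integral_const_mul]
  congr 1
  ext s
  rw [expSum, Finset.sum_eq_single_of_mem k hk]
  · simp only [norm_mul, norm_prod]
    ring
  · intro i hi hik
    rw [Finset.prod_eq_zero (Finset.mem_erase.2 ⟨hik, hi⟩) (sub_self _)]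
    simp

theorem exists_int_weight : ∃ q : ℤ → ℝ, Summable q ∧ (∀ j, 0 ≤ q j) ∧ ∀ j : ℤ, j ≠ 0 →
    1 / (j : ℝ) ^ 2 ≤ q j ∧ |(j : ℝ)| * q j ≤ 1 ∧ 1 / ((j : ℝ) ^ 2 * q j) ^ 3 = q j := by
  refine ⟨fun j => |(j : ℝ)| ^ (-(3 / 2) : ℝ), ?_, fun j => by positivity, fun j hj => ?_⟩
  · exact Real.summable_abs_int_rpow (by norm_num)
  · have h1 : (1 : ℝ) ≤ |(j : ℝ)| := by exact_mod_cast Int.one_le_abs hj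
    rw [← sq_abs (j : ℝ)]
    beta_reduce
    generalize |(j : ℝ)| = y at h1 ⊢
    obtain ⟨r, hr, hry⟩ : ∃ r : ℝ, 1 ≤ r ∧ y = r ^ 2 :=
      ⟨√y, Real.one_le_sqrt.2 h1, (Real.sq_sqrt (by linarith)).symm⟩
    have hr0 : 0 < r := by linarith
    have h2 : y ^ (-(3 / 2) : ℝ) = (r ^ 3)⁻¹ := by
      rw [hry, ← Real.rpow_natCast r 2, ← Real.rpow_mul hr0.le, ← Real.rpow_natCast r 3,
        ← Real.rpow_neg hr0.le]
      norm_num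
    simp only [h2]
    rw [hry]
    refine ⟨?_, ?_, by field_simp⟩
    · rw [← one_div]
      refine one_div_le_one_div_of_le (by positivity) ?_
      rw [← pow_mul]
      exact pow_le_pow_right₀ hr (by norm_num)
    · rw [← div_eq_mul_inv, div_le_one (by positivity)]
      exact pow_le_pow_right₀ hr (by norm_num)

theorem norm_one_sub_exp_ge_abs (w : ℂ) : |1 - Real.exp w.re| ≤ ‖1 - Complex.exp w‖ := by
  have h := abs_norm_sub_norm_le (1 : ℂ) (Complex.exp w)
  rwa [norm_one, Complex.norm_exp] at h

theorem norm_one_sub_exp_ge_re (w : ℂ) : min 1 |w.re| / 2 ≤ ‖1 - Complex.exp w‖ := by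
  refine le_trans ?_ (norm_one_sub_exp_ge_abs w)
  rcases le_total 0 w.re with h | h
  · have h1 := Real.add_one_le_exp w.re
    rw [abs_of_nonneg h, abs_sub_comm, abs_of_nonneg (by linarith)]
    linarith [min_le_right 1 w.re]
  · have h1 := Real.add_one_le_exp (-w.re)
    have h2 : Real.exp w.re * Real.exp (-w.re) = 1 := by rw [← Real.exp_add]; simp
    have h3 : Real.exp w.re ≤ 1 := Real.exp_le_one_iff.2 h
    have h4 : 0 ≤ min 1 |w.re| := by positivity
    have h5 : min 1 |w.re| ≤ 1 := min_le_left _ _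
    have h6 : min 1 |w.re| ≤ -w.re := (min_le_right _ _).trans (abs_of_nonpos h).le
    rw [abs_of_nonneg (sub_nonneg.2 h3)]
    set m := min 1 |w.re|
    have h7 : Real.exp w.re * (1 + m) ≤ 1 := by
      rw [← h2]; gcongr; linarith
    nlinarith [Real.exp_pos w.re]

theorem norm_one_sub_exp_ge_norm {w : ℂ} (hw : ‖w‖ ≤ 1 / 2) :
    ‖w‖ / 2 ≤ ‖1 - Complex.exp w‖ := by
  have h1 := Complex.norm_exp_sub_one_sub_id_le (x := w) (by linarith)
  have h2 : ‖w‖ ≤ ‖Complex.exp w - 1 - w‖ + ‖1 - Complex.exp w‖ := by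
    have := norm_add_le (Complex.exp w - 1 - w) (1 - Complex.exp w)
    rw [show Complex.exp w - 1 - w + (1 - Complex.exp w) = -w by ring, norm_neg] at this
    exact this
  nlinarith [norm_nonneg w]

theorem cube_div_six_le_exp_sub_one {y : ℝ} (hy : 0 ≤ y) : y ^ 3 / 6 ≤ Real.exp y - 1 := by
  have h := Real.sum_le_exp_of_nonneg hy 4
  simp [Finset.sum_range_succ, Nat.factorial] at h
  nlinarith [sq_nonneg y]

theorem exp_neg_le_six_div_cube {y : ℝ} (hy : 0 < y) : Real.exp (-y) ≤ 6 / y ^ 3 := by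
  have h := cube_div_six_le_exp_sub_one hy.le
  rw [Real.exp_neg, inv_eq_one_div, div_le_div_iff₀ (Real.exp_pos y) (by positivity)]
  linarith

theorem norm_one_sub_exp_ge_exp {w : ℂ} {y : ℝ} (hy : 0 < y) (hw : w.re ≤ -y) :
    Real.exp (-(6 / y ^ 3)) ≤ ‖1 - Complex.exp w‖ := by
  have h1 : Real.exp w.re ≤ Real.exp (-y) := Real.exp_le_exp.2 hw
  have h2 : Real.exp (-y) < 1 := Real.exp_lt_one_iff.2 (by linarith)
  refine le_trans ?_ (norm_one_sub_exp_ge_abs w)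
  rw [abs_of_nonneg (by linarith)]
  refine le_trans ?_ (sub_le_sub_left h1 1)
  have h3 := cube_div_six_le_exp_sub_one hy.le
  have h4 := Real.add_one_le_exp (6 / y ^ 3)
  rw [Real.exp_neg, Real.exp_neg]
  have h5 : 0 < Real.exp y := Real.exp_pos y
  have h6 : 1 - (Real.exp y)⁻¹ = (Real.exp y - 1) / Real.exp y := by field_simp
  rw [h6, inv_eq_one_div, div_le_div_iff₀ (Real.exp_pos _) h5]
  have h7 : 1 ≤ (Real.exp y - 1) * (6 / y ^ 3) := by
    rw [mul_div_assoc', le_div_iff₀ (by positivity)]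
    linarith
  have h8 : (Real.exp y - 1) * (6 / y ^ 3 + 1) ≤ (Real.exp y - 1) * Real.exp (6 / y ^ 3) :=
    mul_le_mul_of_nonneg_left h4 (by linarith [show 0 < y ^ 3 by positivity])
  linarith

theorem norm_exp_sub_exp_eq (a b : ℂ) :
    ‖Complex.exp a - Complex.exp b‖ = Real.exp a.re * ‖1 - Complex.exp (b - a)‖ := by
  rw [← Complex.norm_exp, ← norm_mul, mul_sub, mul_one, ← Complex.exp_add]
  congr 3
  ring

section Parabolic

theorem parabolic_re_im {z : ℤ → ℂ} {μ u K : ℝ}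
    (hz : ∀ j : ℤ, j ≠ 0 → ‖z j - (-(μ * (j : ℝ) ^ 2 : ℝ) + Complex.I * (u * j : ℝ))‖ ≤ K)
    {j : ℤ} (hj : j ≠ 0) :
    |(z j).re + μ * (j : ℝ) ^ 2| ≤ K ∧ |(z j).im - u * j| ≤ K := by
  have h1 := (Complex.abs_re_le_norm _).trans (hz j hj)
  have h2 := (Complex.abs_im_le_norm _).trans (hz j hj)
  simp only [Complex.sub_re, Complex.add_re, Complex.neg_re, Complex.ofReal_re, Complex.mul_re,
    Complex.I_re, Complex.I_im, Complex.ofReal_im, Complex.sub_im, Complex.add_im, Complex.neg_im,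
    Complex.mul_im] at h1 h2
  ring_nf at h1 h2 ⊢
  exact ⟨h1, h2⟩

theorem parabolic_re_gap {z : ℤ → ℂ} {μ u K N : ℝ} (hμ : 0 < μ)
    (hz : ∀ j : ℤ, j ≠ 0 → ‖z j - (-(μ * (j : ℝ) ^ 2 : ℝ) + Complex.I * (u * j : ℝ))‖ ≤ K)
    (hN : 1 ≤ N) (hNμ : 4 * K ≤ μ * N) {j k : ℤ} (hj : N < |(j : ℝ)|) (hk : N < |(k : ℝ)|)
    (hkj : |(k : ℝ)| < |(j : ℝ)|) :
    μ / 2 * ((j : ℝ) ^ 2 - (k : ℝ) ^ 2) ≤ (z k).re - (z j).re ∧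
      1 ≤ (j : ℝ) ^ 2 - (k : ℝ) ^ 2 := by
  have hj0 : j ≠ 0 := by rintro rfl; simp at hj; linarith
  have hk0 : k ≠ 0 := by rintro rfl; simp at hk; linarith
  have h1 := abs_le.1 (parabolic_re_im hz hj0).1
  have h2 := abs_le.1 (parabolic_re_im hz hk0).1
  have h3 : |(k : ℝ)| + 1 ≤ |(j : ℝ)| := by
    have : |k| < |j| := by exact_mod_cast hkj
    exact_mod_cast this
  have h4 : 2 * N ≤ (j : ℝ) ^ 2 - (k : ℝ) ^ 2 := by
    rw [← sq_abs (j : ℝ), ← sq_abs (k : ℝ)]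
    nlinarith
  refine ⟨?_, by linarith⟩
  nlinarith

theorem parabolic_factor_antipodal {z : ℤ → ℂ} {μ u K N σ : ℝ} (hu : 0 < u)
    (hK : 0 ≤ K)
    (hz : ∀ j : ℤ, j ≠ 0 → ‖z j - (-(μ * (j : ℝ) ^ 2 : ℝ) + Complex.I * (u * j : ℝ))‖ ≤ K)
    (hN : 1 ≤ N) (hNu : 2 * K ≤ u * N)
    {q : ℤ → ℝ} (hq0 : ∀ j, 0 ≤ q j) (hq : ∀ j : ℤ, j ≠ 0 →
      1 / (j : ℝ) ^ 2 ≤ q j ∧ |(j : ℝ)| * q j ≤ 1)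
    (hσ : 0 < σ) (hσu : (2 * u + 2 * K) * σ ≤ 1 / 2)
    {j k : ℤ} (hk : N < |(k : ℝ)|) (hjk' : j = -k) :
    u / 2 * σ / (k : ℝ) ^ 2
      ≤ ‖1 - Complex.exp (z j * (σ * q j : ℝ) - z k * (σ * q j : ℝ))‖ := by
  have hk0 : k ≠ 0 := by rintro rfl; simp at hk; linarith
  have hj0 : j ≠ 0 := by simpa [hjk'] using hk0
  have hk1 : (1 : ℝ) ≤ |(k : ℝ)| := by linarith
  have hjr : (j : ℝ) = -k := by exact_mod_cast hjk'
  have habs : |(j : ℝ)| = |(k : ℝ)| := by rw [hjr, abs_neg]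
  have hqk : |(k : ℝ)| * q j ≤ 1 := by rw [← habs]; exact (hq j hj0).2
  have hw : z j * (σ * q j : ℝ) - z k * (σ * q j : ℝ) = (z j - z k) * (σ * q j : ℝ) := by ring
  have hnw : ‖(z j - z k) * ((σ * q j : ℝ) : ℂ)‖ = ‖z j - z k‖ * (σ * q j) := by
    rw [norm_mul, Complex.norm_real, Real.norm_of_nonneg (mul_nonneg hσ.le (hq0 j))]
  have hup : ‖z j - z k‖ ≤ (2 * u + 2 * K) * |(k : ℝ)| := by
    have e : z j - z k = (z j - (-(μ * (j : ℝ) ^ 2 : ℝ) + Complex.I * (u * j : ℝ)))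
        - (z k - (-(μ * (k : ℝ) ^ 2 : ℝ) + Complex.I * (u * k : ℝ)))
        + ((-2 * u * k : ℝ) : ℂ) * Complex.I := by
      rw [hjr]; push_cast; ring
    have h1 : ‖((-2 * u * k : ℝ) : ℂ) * Complex.I‖ = 2 * u * |(k : ℝ)| := by
      rw [norm_mul, Complex.norm_I, Complex.norm_real, Real.norm_eq_abs, abs_mul, abs_mul,
        abs_of_pos hu]
      norm_num
    calc ‖z j - z k‖ ≤ K + K + 2 * u * |(k : ℝ)| := by
          rw [e]
          refine (norm_add_le _ _).trans (add_le_add ((norm_sub_le _ _).trans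
            (add_le_add (hz j hj0) (hz k hk0))) h1.le)
      _ ≤ _ := by nlinarith
  have hlow : u * |(k : ℝ)| ≤ ‖z j - z k‖ := by
    refine le_trans ?_ (Complex.abs_im_le_norm _)
    have h1 := (parabolic_re_im hz hj0).2
    have h2 := (parabolic_re_im hz hk0).2
    have h3 : u * |(k : ℝ)| ≤ 2 * u * |(k : ℝ)| - 2 * K := by nlinarith
    have h4 : |2 * u * (k : ℝ)| = 2 * u * |(k : ℝ)| := by
      rw [abs_mul, abs_of_pos (by linarith)]
    have h5 : 2 * u * (k : ℝ) = ((z j).im - u * j) - ((z k).im - u * k) - (z j - z k).im := by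
      rw [hjr, Complex.sub_im]; ring
    have h6 : |2 * u * (k : ℝ)| ≤ K + K + |(z j - z k).im| := by
      rw [h5]
      exact (abs_sub _ _).trans (add_le_add_left ((abs_sub _ _).trans (add_le_add h1 h2)) _)
    linarith
  rw [hw]
  refine le_trans ?_ (norm_one_sub_exp_ge_norm ?_)
  · rw [hnw]
    have h1 : σ / (k : ℝ) ^ 2 ≤ |(k : ℝ)| * (σ * q j) := by
      have := (hq j hj0).1
      have hjr : (j : ℝ) ^ 2 = (k : ℝ) ^ 2 := by rw [hjr, neg_sq]
      rw [hjr] at this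
      calc σ / (k : ℝ) ^ 2 = 1 * (σ * (1 / (k : ℝ) ^ 2)) := by ring
        _ ≤ _ := by gcongr
    calc u / 2 * σ / (k : ℝ) ^ 2 = u / 2 * (σ / (k : ℝ) ^ 2) := by ring
      _ ≤ u / 2 * (|(k : ℝ)| * (σ * q j)) := by gcongr
      _ = u * |(k : ℝ)| * (σ * q j) / 2 := by ring
      _ ≤ _ := by have := hq0 j; gcongr
  · rw [hnw]
    calc ‖z j - z k‖ * (σ * q j) ≤ (2 * u + 2 * K) * |(k : ℝ)| * (σ * q j) := by
          have := hq0 j; gcongr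
      _ = (2 * u + 2 * K) * σ * (|(k : ℝ)| * q j) := by ring
      _ ≤ (2 * u + 2 * K) * σ * 1 := by gcongr
      _ ≤ _ := by linarith

theorem parabolic_factor_near {z : ℤ → ℂ} {μ u K N σ : ℝ} (hμ : 0 < μ) (hu : 0 < u)
    (hK : 0 ≤ K)
    (hz : ∀ j : ℤ, j ≠ 0 → ‖z j - (-(μ * (j : ℝ) ^ 2 : ℝ) + Complex.I * (u * j : ℝ))‖ ≤ K)
    (hN : 1 ≤ N) (hNμ : 4 * K ≤ μ * N) (hNu : 2 * K ≤ u * N)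
    {q : ℤ → ℝ} (hq0 : ∀ j, 0 ≤ q j) (hq : ∀ j : ℤ, j ≠ 0 →
      1 / (j : ℝ) ^ 2 ≤ q j ∧ |(j : ℝ)| * q j ≤ 1)
    (hσ : 0 < σ) (hσμ : μ * σ ≤ 1) (hσu : (2 * u + 2 * K) * σ ≤ 1 / 2)
    {j k : ℤ} (hj : N < |(j : ℝ)|) (hk : N < |(k : ℝ)|) (hjk : j ≠ k)
    (hnear : |(j : ℝ)| ≤ 2 * |(k : ℝ)|) :
    min (μ / 16) (u / 2) * σ / (k : ℝ) ^ 2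
      ≤ ‖1 - Complex.exp (z j * (σ * q j : ℝ) - z k * (σ * q j : ℝ))‖ := by
  have hj0 : j ≠ 0 := by rintro rfl; simp at hj; linarith
  have hk0 : k ≠ 0 := by rintro rfl; simp at hk; linarith
  have hk1 : (1 : ℝ) ≤ (k : ℝ) ^ 2 := by rw [← sq_abs]; nlinarith
  have hj1 : (1 : ℝ) ≤ (j : ℝ) ^ 2 := by rw [← sq_abs]; nlinarith
  have hjk2 : (j : ℝ) ^ 2 ≤ 4 * (k : ℝ) ^ 2 := by
    rw [← sq_abs (j : ℝ), ← sq_abs (k : ℝ)]; nlinarith [abs_nonneg (j : ℝ)]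
  have hqj : 1 / (4 * (k : ℝ) ^ 2) ≤ q j :=
    (one_div_le_one_div_of_le (by linarith) hjk2).trans (hq j hj0).1
  have hre : (z j * (σ * q j : ℝ) - z k * (σ * q j : ℝ)).re
      = ((z j).re - (z k).re) * (σ * q j) := by
    simp only [Complex.sub_re, Complex.re_mul_ofReal]; ring
  have hx : 0 ≤ σ / (k : ℝ) ^ 2 := by positivity
  have hqσ : σ / (4 * (k : ℝ) ^ 2) ≤ σ * q j := by
    calc σ / (4 * (k : ℝ) ^ 2) = σ * (1 / (4 * (k : ℝ) ^ 2)) := by ring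
      _ ≤ _ := by gcongr
  by_cases habs : |(j : ℝ)| = |(k : ℝ)|
  · have hjk' : j = -k := by
      rcases abs_eq_abs.1 habs with h | h
      · exact absurd (by exact_mod_cast h) hjk
      · exact_mod_cast h
    refine le_trans ?_ (parabolic_factor_antipodal hu hK hz hN hNu hq0 hq hσ hσu hk hjk')
    gcongr
    exact min_le_right _ _
  · have hgap : μ / 2 ≤ |(z j).re - (z k).re| := by
      rcases lt_or_gt_of_ne habs with h | h
      · have := parabolic_re_gap hμ hz hN hNμ hk hj h
        refine le_trans ?_ (le_abs_self _)
        nlinarith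
      · have := parabolic_re_gap hμ hz hN hNμ hj hk h
        refine le_trans ?_ (neg_le_abs _)
        nlinarith
    refine le_trans ?_ (norm_one_sub_exp_ge_re _)
    rw [hre, abs_mul, abs_of_nonneg (mul_nonneg hσ.le (hq0 j)), le_div_iff₀ two_pos]
    have h1 : min (μ / 16) (u / 2) * σ / (k : ℝ) ^ 2 * 2 ≤ μ / 2 * (σ / (4 * (k : ℝ) ^ 2)) := by
      calc min (μ / 16) (u / 2) * σ / (k : ℝ) ^ 2 * 2
          = min (μ / 16) (u / 2) * (σ / (k : ℝ) ^ 2 * 2) := by ring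
        _ ≤ μ / 16 * (σ / (k : ℝ) ^ 2 * 2) := by gcongr; exact min_le_left _ _
        _ = _ := by ring
    refine le_min (h1.trans ?_) (h1.trans (mul_le_mul hgap hqσ (by positivity) (abs_nonneg _)))
    rw [div_mul_div_comm, div_le_one (by positivity)]
    linarith

theorem parabolic_factor_far {z : ℤ → ℂ} {μ u K N σ : ℝ} (hμ : 0 < μ)
    (hz : ∀ j : ℤ, j ≠ 0 → ‖z j - (-(μ * (j : ℝ) ^ 2 : ℝ) + Complex.I * (u * j : ℝ))‖ ≤ K)
    (hN : 1 ≤ N) (hNμ : 4 * K ≤ μ * N)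
    {q : ℤ → ℝ} (hq : ∀ j : ℤ, j ≠ 0 →
      1 / (j : ℝ) ^ 2 ≤ q j ∧ 1 / ((j : ℝ) ^ 2 * q j) ^ 3 = q j)
    (hσ : 0 < σ)
    {j k : ℤ} (hj : N < |(j : ℝ)|) (hk : N < |(k : ℝ)|)
    (hfar : 2 * |(k : ℝ)| < |(j : ℝ)|) :
    Real.exp (-(6 * (4 / (μ * σ)) ^ 3 * q j))
      ≤ ‖1 - Complex.exp (z j * (σ * q j : ℝ) - z k * (σ * q j : ℝ))‖ := by
  have hj0 : j ≠ 0 := by rintro rfl; simp at hj; linarith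
  have hj1 : (1 : ℝ) ≤ (j : ℝ) ^ 2 := by rw [← sq_abs]; nlinarith
  have hqpos : 0 < q j := lt_of_lt_of_le (by positivity) (hq j hj0).1
  have hgap := parabolic_re_gap hμ hz hN hNμ hj hk (by linarith)
  have hsq : 4 * (k : ℝ) ^ 2 ≤ (j : ℝ) ^ 2 := by
    rw [← sq_abs (j : ℝ), ← sq_abs (k : ℝ)]; nlinarith [abs_nonneg (k : ℝ)]
  have h1 : μ / 4 * (j : ℝ) ^ 2 ≤ (z k).re - (z j).re := by nlinarith
  have h2 : 6 / (μ * σ / 4 * ((j : ℝ) ^ 2 * q j)) ^ 3 = 6 * (4 / (μ * σ)) ^ 3 * q j := by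
    conv_rhs => rw [← (hq j hj0).2]
    field_simp
  rw [← h2]
  refine norm_one_sub_exp_ge_exp (by positivity) ?_
  simp only [Complex.sub_re, Complex.re_mul_ofReal]
  have h3 := mul_le_mul_of_nonneg_right h1 (mul_pos hσ hqpos).le
  linarith

end Parabolic

theorem summable_int_inv_sq : Summable fun j : ℤ => 1 / (j : ℝ) ^ 2 :=
  Real.summable_one_div_int_pow.2 one_lt_two

theorem summable_int_exp_neg_sq {a : ℝ} (ha : 0 < a) :
    Summable fun j : ℤ => Real.exp (-(a * (j : ℝ) ^ 2)) := by
  have h : Summable fun j : ℤ => 1 / a * (1 / (j : ℝ) ^ 2) :=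
    summable_int_inv_sq.mul_left _
  refine Summable.of_norm_bounded_eventually h ?_
  filter_upwards [(Set.finite_singleton (0 : ℤ)).compl_mem_cofinite] with j hj
  have hj0 : (j : ℝ) ≠ 0 := by exact_mod_cast hj
  have hpos : 0 < a * (j : ℝ) ^ 2 := by positivity
  have h1 := Real.add_one_le_exp (a * (j : ℝ) ^ 2)
  rw [Real.norm_of_nonneg (Real.exp_pos _).le, Real.exp_neg, ← one_div, one_div_mul_one_div]
  exact one_div_le_one_div_of_le hpos (by linarith)

section Parabolic

/-- The eigenvalue exponents of parabolic type admit a summable sequence of shifts whose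
annihilating products are bounded above, and bounded below up to a small Gaussian loss. -/
theorem exists_parabolic_shifts {z : ℤ → ℂ} {μ u K N : ℝ} (hμ : 0 < μ) (hu : 0 < u) (hK : 0 ≤ K)
    (hz : ∀ j : ℤ, j ≠ 0 → ‖z j - (-(μ * (j : ℝ) ^ 2 : ℝ) + Complex.I * (u * j : ℝ))‖ ≤ K)
    (hN : 1 ≤ N) (hNμ : 4 * K ≤ μ * N) (hNu : 2 * K ≤ u * N)
    {δ η : ℝ} (hδ : 0 < δ) (hη : 0 < η) :
    ∃ h : ℤ → ℝ, (∀ j, 0 ≤ h j) ∧ (∀ S : Finset ℤ, ∑ j ∈ S, h j ≤ δ) ∧ ∃ B L : ℝ,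
      ∀ S : Finset ℤ, (∀ j ∈ S, N < |(j : ℝ)|) → ∀ k ∈ S,
        ∏ j ∈ S.erase k, (1 + ‖Complex.exp (z j * h j)‖) ≤ Real.exp B ∧
        Real.exp (-((η + μ * δ) * (k : ℝ) ^ 2 + L))
          ≤ ∏ j ∈ S.erase k, ‖Complex.exp (z k * h j) - Complex.exp (z j * h j)‖ := by
  obtain ⟨q, hqs, hq0, hq⟩ := exists_int_weight
  set Q := ∑' j, q j with hQ
  have hQ0 : 0 ≤ Q := tsum_nonneg hq0
  have hQS : ∀ S : Finset ℤ, ∑ j ∈ S, q j ≤ Q := fun S => hqs.sum_le_tsum S fun j _ => hq0 j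
  obtain ⟨σ, hσ, hσ1, hσ2, hσ3⟩ : ∃ σ : ℝ, 0 < σ ∧ μ * σ ≤ 1 ∧ (2 * u + 2 * K) * σ ≤ 1 / 2 ∧
      σ * Q ≤ δ := by
    refine ⟨min (1 / μ) (min (1 / 2 / (2 * u + 2 * K)) (δ / (Q + 1))), by positivity, ?_, ?_, ?_⟩
    · rw [mul_comm, ← le_div_iff₀ hμ]; exact min_le_left _ _
    · rw [mul_comm, ← le_div_iff₀ (by positivity)]
      exact (min_le_right _ _).trans (min_le_left _ _)
    · calc _ ≤ δ / (Q + 1) * (Q + 1) := by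
            gcongr
            · exact (min_le_right _ _).trans (min_le_right _ _)
            · linarith
        _ = δ := by field_simp
  set D := 6 * (4 / (μ * σ)) ^ 3 with hD
  have hD0 : 0 ≤ D := by positivity
  set c := min (μ / 16) (u / 2) * σ with hc
  have hc0 : 0 < c := by positivity
  set θ := η / 20 with hθ
  have hθ0 : 0 < θ := by positivity
  set M := |Real.log (c * θ ^ 2)| with hM
  have hM0 : 0 ≤ M := abs_nonneg _
  have hsum : ∀ S : Finset ℤ, ∑ j ∈ S, σ * q j ≤ δ := fun S => by
    rw [← Finset.mul_sum]
    exact (mul_le_mul_of_nonneg_left (hQS S) hσ.le).trans hσ3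
  refine ⟨fun j => σ * q j, fun j => mul_nonneg hσ.le (hq0 j), hsum, D * Q,
    K * δ + 25 * M ^ 2 / (2 * η) + D * Q, fun S hS k hk => ⟨?_, ?_⟩⟩
  · calc ∏ j ∈ S.erase k, (1 + ‖Complex.exp (z j * (σ * q j : ℝ))‖)
        ≤ ∏ j ∈ S.erase k, Real.exp (D * q j) := by
          refine Finset.prod_le_prod (fun j _ => by positivity) fun j hj => ?_
          have hjS := hS j (Finset.mem_of_mem_erase hj)
          have hj0 : j ≠ 0 := by rintro rfl; simp at hjS; linarith
          have hj1 : (1 : ℝ) ≤ (j : ℝ) ^ 2 := by rw [← sq_abs]; nlinarith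
          have hqpos : 0 < q j := lt_of_lt_of_le (by positivity) (hq j hj0).1
          have h1 := abs_le.1 (parabolic_re_im hz hj0).1
          have h2 : (z j).re ≤ -(μ / 4 * (j : ℝ) ^ 2) := by
            have : N ≤ (j : ℝ) ^ 2 := by rw [← sq_abs]; nlinarith
            nlinarith
          have h3 : 6 / (μ * σ / 4 * ((j : ℝ) ^ 2 * q j)) ^ 3 = D * q j := by
            rw [hD]
            conv_rhs => rw [← (hq j hj0).2.2]
            field_simp
          rw [Complex.norm_exp, Complex.re_mul_ofReal]
          have h4 : (z j).re * (σ * q j) ≤ -(μ * σ / 4 * ((j : ℝ) ^ 2 * q j)) := by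
            have := mul_le_mul_of_nonneg_right h2 (mul_pos hσ hqpos).le
            linarith
          have h5 := (Real.exp_le_exp.2 h4).trans (exp_neg_le_six_div_cube (by positivity))
          rw [h3] at h5
          linarith [Real.add_one_le_exp (D * q j)]
      _ = Real.exp (∑ j ∈ S.erase k, D * q j) := (Real.exp_sum _ _).symm
      _ ≤ Real.exp (D * Q) := by
          rw [← Finset.mul_sum]
          exact Real.exp_le_exp.2 (mul_le_mul_of_nonneg_left (hQS _) hD0)
  · have hkN := hS k hk
    have hk0 : k ≠ 0 := by rintro rfl; simp at hkN; linarith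
    have hk1 : (1 : ℝ) ≤ |(k : ℝ)| := by linarith
    have hzk := abs_le.1 (parabolic_re_im hz hk0).1
    set e : ℤ → ℝ := fun j => (μ * (k : ℝ) ^ 2 + K) * (σ * q j)
      + ((if |(j : ℝ)| ≤ 2 * |(k : ℝ)| then 2 * θ * |(k : ℝ)| + M else 0) + D * q j) with he
    have hfac : ∀ j ∈ S.erase k,
        Real.exp (-e j) ≤ ‖Complex.exp (z k * (σ * q j : ℝ)) - Complex.exp (z j * (σ * q j : ℝ))‖ := by
      intro j hj
      have hjS := hS j (Finset.mem_of_mem_erase hj)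
      have hjk := Finset.ne_of_mem_erase hj
      rw [norm_exp_sub_exp_eq, he, neg_add, Real.exp_add]
      refine mul_le_mul ?_ ?_ (Real.exp_pos _).le (Real.exp_pos _).le
      · rw [Complex.re_mul_ofReal, Real.exp_le_exp, ← neg_mul]
        exact mul_le_mul_of_nonneg_right (by linarith) (mul_nonneg hσ.le (hq0 j))
      · split_ifs with hif
        · refine le_trans ?_ (parabolic_factor_near hμ hu hK hz hN hNμ hNu hq0
            (fun j hj => ⟨(hq j hj).1, (hq j hj).2.1⟩) hσ hσ1 hσ2 hjS hkN hjk hif)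
          have h1 := Real.add_one_le_exp (θ * |(k : ℝ)|)
          have h2 : (θ * |(k : ℝ)|) ^ 2 ≤ Real.exp (2 * θ * |(k : ℝ)|) := by
            calc (θ * |(k : ℝ)|) ^ 2 ≤ Real.exp (θ * |(k : ℝ)|) ^ 2 := by
                  gcongr; linarith
              _ = _ := by rw [← Real.exp_nat_mul]; congr 1; push_cast; ring
          have h3 : Real.exp (-M) ≤ c * θ ^ 2 := by
            calc Real.exp (-M) ≤ Real.exp (Real.log (c * θ ^ 2)) :=
                  Real.exp_le_exp.2 (neg_abs_le _)
              _ = _ := Real.exp_log (by positivity)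
          calc Real.exp (-(2 * θ * |(k : ℝ)| + M + D * q j))
              ≤ Real.exp (-(2 * θ * |(k : ℝ)|) + -M) := by
                refine Real.exp_le_exp.2 ?_
                linarith [mul_nonneg hD0 (hq0 j)]
            _ = Real.exp (-M) / Real.exp (2 * θ * |(k : ℝ)|) := by
                rw [Real.exp_add, Real.exp_neg (2 * θ * |(k : ℝ)|)]; ring
            _ ≤ c * θ ^ 2 / (θ * |(k : ℝ)|) ^ 2 := by gcongr
            _ = c / (k : ℝ) ^ 2 := by rw [mul_pow, sq_abs]; field_simp
        · rw [zero_add]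
          exact parabolic_factor_far hμ hz hN hNμ (fun j hj => ⟨(hq j hj).1, (hq j hj).2.2⟩) hσ
            hjS hkN (not_le.1 hif)
    calc Real.exp (-((η + μ * δ) * (k : ℝ) ^ 2 + (K * δ + 25 * M ^ 2 / (2 * η) + D * Q)))
        ≤ Real.exp (∑ j ∈ S.erase k, -e j) := by
          refine Real.exp_le_exp.2 ?_
          rw [Finset.sum_neg_distrib, neg_le_neg_iff, he]
          simp only [Finset.sum_add_distrib]
          rw [← Finset.mul_sum, ← Finset.mul_sum _ _ D, ← Finset.sum_filter, Finset.sum_const,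
            nsmul_eq_mul]
          have hcard : (((S.erase k).filter fun j : ℤ => |(j : ℝ)| ≤ 2 * |(k : ℝ)|).card : ℝ)
              ≤ 5 * |(k : ℝ)| := by
            have hsub : ((S.erase k).filter fun j : ℤ => |(j : ℝ)| ≤ 2 * |(k : ℝ)|)
                ⊆ Finset.Icc (-(2 * |k|)) (2 * |k|) := by
              intro j hj
              have h1 : |j| ≤ 2 * |k| := by exact_mod_cast (Finset.mem_filter.1 hj).2
              exact Finset.mem_Icc.2 (abs_le.1 h1)
            have h1 := Finset.card_le_card hsub
            rw [Int.card_Icc] at h1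
            have h2 := Int.one_le_abs hk0
            have h3 : (((S.erase k).filter fun j : ℤ => |(j : ℝ)| ≤ 2 * |(k : ℝ)|).card : ℤ)
                ≤ 5 * |k| := by omega
            exact_mod_cast h3
          have h1 : (μ * (k : ℝ) ^ 2 + K) * ∑ j ∈ S.erase k, σ * q j
              ≤ (μ * (k : ℝ) ^ 2 + K) * δ := by
            gcongr; exact hsum _
          have h2 := mul_le_mul_of_nonneg_left (hQS (S.erase k)) hD0
          have h3 := mul_le_mul_of_nonneg_right hcard
            (show 0 ≤ 2 * θ * |(k : ℝ)| + M by positivity)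
          have h4 : 5 * |(k : ℝ)| * (2 * θ * |(k : ℝ)| + M)
              ≤ η * (k : ℝ) ^ 2 + 25 * M ^ 2 / (2 * η) := by
            have h5 : η * |(k : ℝ)| ^ 2 + 25 * M ^ 2 / (2 * η)
                - 5 * |(k : ℝ)| * (2 * θ * |(k : ℝ)| + M)
                = (η * |(k : ℝ)| - 5 * M) ^ 2 / (2 * η) := by
              rw [hθ]; field_simp; ring
            have h6 : 0 ≤ (η * |(k : ℝ)| - 5 * M) ^ 2 / (2 * η) := by positivity
            rw [← sq_abs (k : ℝ)]
            linarith
          linarith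
      _ = ∏ j ∈ S.erase k, Real.exp (-e j) := Real.exp_sum _ _
      _ ≤ _ := Finset.prod_le_prod (fun j _ => (Real.exp_pos _).le) hfac

theorem parabolic_observability {z : ℤ → ℂ} {μ u K N : ℝ} (hμ : 0 < μ) (hu : 0 < u) (hK : 0 ≤ K)
    (hz : ∀ j : ℤ, j ≠ 0 → ‖z j - (-(μ * (j : ℝ) ^ 2 : ℝ) + Complex.I * (u * j : ℝ))‖ ≤ K)
    (hN : 1 ≤ N) (hNμ : 4 * K ≤ μ * N) (hNu : 2 * K ≤ u * N)
    {τ τ' : ℝ} (hτ : 0 < τ) (hτ' : 0 < τ') :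
    ∃ C > 0, ∀ S : Finset ℤ, (∀ j ∈ S, N < |(j : ℝ)|) → ∀ x : ℤ → ℂ,
      ∑ k ∈ S, Real.exp (2 * (z k).re * τ') * ‖x k‖ ^ 2
        ≤ C * ∫ s in (0 : ℝ)..τ, ‖expSum z S x s‖ ^ 2 := by
  set r := min (τ / 2) (τ' / 4) with hr
  have hr0 : 0 < r := by positivity
  have hr1 : r ≤ τ / 2 := min_le_left _ _
  have hr2 : r ≤ τ' / 4 := min_le_right _ _
  set η := μ * τ' / 4 with hη
  obtain ⟨h, hh0, hhS, B, L, hBL⟩ := exists_parabolic_shifts hμ hu hK hz hN hNμ hNu hr0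
    (show 0 < η by positivity)
  have hsumm := summable_int_exp_neg_sq (show 0 < μ * τ' / 2 by positivity)
  set G := ∑' j : ℤ, Real.exp (-(μ * τ' / 2 * (j : ℝ) ^ 2)) with hG
  set A := Real.exp (2 * B + 2 * L + 2 * K * r + 2 * K * τ') / r with hA
  have hA0 : 0 < A := by positivity
  have hG0 : 0 < G := hsumm.tsum_pos (fun j => (Real.exp_pos _).le) 0 (Real.exp_pos _)
  refine ⟨A * G, by positivity, fun S hS x => ?_⟩
  set I := ∫ s in (0 : ℝ)..τ, ‖expSum z S x s‖ ^ 2 with hI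
  have hI0 : 0 ≤ I := integral_norm_sq_nonneg _ hτ.le
  have key : ∀ k ∈ S, Real.exp (2 * (z k).re * τ') * ‖x k‖ ^ 2
      ≤ A * I * Real.exp (-(μ * τ' / 2 * (k : ℝ) ^ 2)) := by
    intro k hk
    have hkN := hS k hk
    have hk0 : k ≠ 0 := by rintro rfl; simp at hkN; linarith
    have hzk := abs_le.1 (parabolic_re_im hz hk0).1
    obtain ⟨h1, h2⟩ := hBL S hS k hk
    have h3 := coeff_bound_of_shifts z S h hh0 x hr0.le hk
    have h4 : ∫ s in (0 : ℝ)..(r + ∑ j ∈ S.erase k, h j), ‖expSum z S x s‖ ^ 2 ≤ I :=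
      integral_norm_sq_mono (continuous_expSum z S x) le_rfl
        (add_nonneg hr0.le (Finset.sum_nonneg fun j _ => hh0 j))
        (by linarith [hhS (S.erase k)])
    have h5 : r * Real.exp (-(2 * (μ * (k : ℝ) ^ 2 + K) * r))
        ≤ ∫ s in (0 : ℝ)..r, ‖Complex.exp (z k * s)‖ ^ 2 := by
      calc r * Real.exp (-(2 * (μ * (k : ℝ) ^ 2 + K) * r))
          = ∫ s in (0 : ℝ)..r, Real.exp (-(2 * (μ * (k : ℝ) ^ 2 + K) * r)) := by simp
        _ ≤ _ := by
          refine intervalIntegral.integral_mono_on hr0.le (by simp)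
            (Continuous.intervalIntegrable (by fun_prop) _ _) fun s hs => ?_
          rw [Complex.norm_exp, Complex.re_mul_ofReal, ← Real.exp_nat_mul, Real.exp_le_exp]
          push_cast
          have h6 : (-(μ * (k : ℝ) ^ 2 + K)) * s ≤ (z k).re * s :=
            mul_le_mul_of_nonneg_right (by linarith) hs.1
          have h7 : (μ * (k : ℝ) ^ 2 + K) * s ≤ (μ * (k : ℝ) ^ 2 + K) * r :=
            mul_le_mul_of_nonneg_left hs.2 (by positivity)
          linarith
    have h6 : ‖x k‖ ^ 2 * Real.exp (-((η + μ * r) * (k : ℝ) ^ 2 + L)) ^ 2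
        * (r * Real.exp (-(2 * (μ * (k : ℝ) ^ 2 + K) * r))) ≤ Real.exp B ^ 2 * I := by
      calc _ ≤ _ := by gcongr
        _ ≤ _ := h3
        _ ≤ _ := by gcongr; exact integral_norm_sq_nonneg _ (add_nonneg hr0.le (Finset.sum_nonneg fun j _ => hh0 j))
    have h7 : ‖x k‖ ^ 2 * (r * Real.exp (-(2 * B + 2 * L + 2 * K * r)
        - (2 * η + 4 * μ * r) * (k : ℝ) ^ 2)) ≤ I := by
      have h8 : 0 < Real.exp B ^ 2 := by positivity
      refine le_of_mul_le_mul_left (le_trans (le_of_eq ?_) h6) h8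
      simp only [← Real.exp_nat_mul]
      have h9 : Real.exp (-(2 * B + 2 * L + 2 * K * r) - (2 * η + 4 * μ * r) * (k : ℝ) ^ 2)
          = Real.exp (-((2 : ℕ) * B)) * Real.exp ((2 : ℕ) * -((η + μ * r) * (k : ℝ) ^ 2 + L))
            * Real.exp (-(2 * (μ * (k : ℝ) ^ 2 + K) * r)) := by
        rw [← Real.exp_add, ← Real.exp_add]
        congr 1
        push_cast
        ring
      rw [h9, Real.exp_neg]
      field_simp
    have h8 : Real.exp (2 * (z k).re * τ')
        ≤ A * Real.exp (-(μ * τ' / 2 * (k : ℝ) ^ 2))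
          * (r * Real.exp (-(2 * B + 2 * L + 2 * K * r) - (2 * η + 4 * μ * r) * (k : ℝ) ^ 2)) := by
      have h9 : A * Real.exp (-(μ * τ' / 2 * (k : ℝ) ^ 2))
          * (r * Real.exp (-(2 * B + 2 * L + 2 * K * r) - (2 * η + 4 * μ * r) * (k : ℝ) ^ 2))
          = Real.exp (2 * K * τ' - (μ * τ' / 2 + 2 * η + 4 * μ * r) * (k : ℝ) ^ 2) := by
        rw [hA]
        field_simp
        rw [← Real.exp_add, ← Real.exp_add]
        congr 1
        ring
      rw [h9, Real.exp_le_exp]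
      have h10 : (z k).re * τ' ≤ (K - μ * (k : ℝ) ^ 2) * τ' :=
        mul_le_mul_of_nonneg_right (by linarith) hτ'.le
      have h11 : μ * r * (k : ℝ) ^ 2 ≤ μ * (τ' / 4) * (k : ℝ) ^ 2 := by gcongr
      rw [hη]
      linarith
    calc Real.exp (2 * (z k).re * τ') * ‖x k‖ ^ 2
        ≤ _ := mul_le_mul_of_nonneg_right h8 (by positivity)
      _ = A * Real.exp (-(μ * τ' / 2 * (k : ℝ) ^ 2)) * (‖x k‖ ^ 2 * (r * Real.exp (-(2 * B + 2 * L + 2 * K * r)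
        - (2 * η + 4 * μ * r) * (k : ℝ) ^ 2))) := by ring
      _ ≤ A * Real.exp (-(μ * τ' / 2 * (k : ℝ) ^ 2)) * I := by gcongr
      _ = _ := by ring
  calc ∑ k ∈ S, Real.exp (2 * (z k).re * τ') * ‖x k‖ ^ 2
      ≤ ∑ k ∈ S, A * I * Real.exp (-(μ * τ' / 2 * (k : ℝ) ^ 2)) := Finset.sum_le_sum key
    _ = A * I * ∑ k ∈ S, Real.exp (-(μ * τ' / 2 * (k : ℝ) ^ 2)) := (Finset.mul_sum _ _ _).symm
    _ ≤ A * I * G := by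
        gcongr
        exact hsumm.sum_le_tsum S fun j _ => (Real.exp_pos _).le
    _ = A * G * I := by ring

end Parabolic

section Hyperbolic

theorem integral_exp_period {u : ℝ} (hu : 0 < u) (k : ℤ) (a : ℝ) (m : ℕ) :
    ∫ s in a..(a + m * (2 * Real.pi / u)), Complex.exp (Complex.I * (u * k : ℝ) * s)
      = if k = 0 then ((m * (2 * Real.pi / u) : ℝ) : ℂ) else 0 := by
  split_ifs with hk
  · simp [hk]
  · have hc : Complex.I * ((u * k : ℝ) : ℂ) ≠ 0 := by
      have : u * (k : ℝ) ≠ 0 := mul_ne_zero hu.ne' (by exact_mod_cast hk)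
      exact mul_ne_zero Complex.I_ne_zero (by exact_mod_cast this)
    rw [integral_exp_mul_complex hc, div_eq_zero_iff]
    left
    rw [sub_eq_zero, Complex.exp_eq_exp_iff_exists_int]
    refine ⟨k * m, ?_⟩
    have hu' : (u : ℂ) ≠ 0 := by exact_mod_cast hu.ne'
    push_cast
    field_simp

theorem integral_norm_fourier_sq {u : ℝ} (hu : 0 < u) (S : Finset ℤ) (A : ℤ → ℂ) (a : ℝ) (m : ℕ) :
    ∫ s in a..(a + m * (2 * Real.pi / u)),
        ‖expSum (fun n : ℤ => Complex.I * (u * n : ℝ)) S A s‖ ^ 2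
      = m * (2 * Real.pi / u) * ∑ n ∈ S, ‖A n‖ ^ 2 := by
  have h1 : ∀ s : ℝ, ((‖expSum (fun n : ℤ => Complex.I * (u * n : ℝ)) S A s‖ ^ 2 : ℝ) : ℂ)
      = ∑ n ∈ S, ∑ l ∈ S, A n * (starRingEnd ℂ) (A l)
          * Complex.exp (Complex.I * (u * (n - l : ℤ) : ℝ) * s) := by
    intro s
    rw [Complex.ofReal_pow, ← Complex.mul_conj', expSum, map_sum, Finset.sum_mul_sum]
    refine Finset.sum_congr rfl fun n _ => Finset.sum_congr rfl fun l _ => ?_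
    rw [map_mul, ← Complex.exp_conj]
    simp only [map_mul, Complex.conj_I, Complex.conj_ofReal]
    rw [mul_mul_mul_comm, ← Complex.exp_add]
    congr 2
    push_cast
    ring
  apply Complex.ofReal_injective
  rw [← intervalIntegral.integral_ofReal]
  simp only [h1]
  rw [intervalIntegral.integral_finsetSum
    fun n _ => Continuous.intervalIntegrable (by fun_prop) _ _]
  have h2 : ∀ n ∈ S, ∫ s in a..(a + m * (2 * Real.pi / u)), ∑ l ∈ S, A n * (starRingEnd ℂ) (A l)
      * Complex.exp (Complex.I * (u * (n - l : ℤ) : ℝ) * s)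
      = ((m * (2 * Real.pi / u) : ℝ) : ℂ) * ((‖A n‖ ^ 2 : ℝ) : ℂ) := by
    intro n hn
    rw [intervalIntegral.integral_finsetSum
      fun n _ => Continuous.intervalIntegrable (by fun_prop) _ _]
    simp only [intervalIntegral.integral_const_mul, integral_exp_period hu]
    rw [Finset.sum_eq_single_of_mem n hn]
    · rw [sub_self, if_pos rfl, Complex.mul_conj']
      push_cast
      ring
    · intro l _ hl
      rw [if_neg (sub_ne_zero.2 hl.symm), mul_zero]
  rw [Finset.sum_congr rfl h2, ← Finset.mul_sum]
  push_cast
  rfl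

theorem norm_exp_sub_exp_le {a b : ℂ} (ha : a.re ≤ 0) (hb : b.re ≤ 0) :
    ‖Complex.exp a - Complex.exp b‖ ≤ ‖a - b‖ := by
  have h := (convex_halfSpace_re_le 0).norm_image_sub_le_of_norm_deriv_le (f := Complex.exp)
    (C := 1) (fun x _ => Complex.differentiableAt_exp) (fun x hx => by
      rw [Complex.deriv_exp, Complex.norm_exp]
      exact Real.exp_le_one_iff.2 hx) hb ha
  rwa [one_mul] at h

theorem norm_sum_mul_sq_le_of_decay {N M : ℝ} (hN : 0 < N) (S : Finset ℤ)
    (hS : ∀ n ∈ S, N ≤ |(n : ℝ)|) (A δ : ℤ → ℂ)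
    (hδ : ∀ n ∈ S, ‖δ n‖ ≤ M / (n : ℝ) ^ 2) :
    ‖∑ n ∈ S, A n * δ n‖ ^ 2
      ≤ M ^ 2 * (∑' n : ℤ, 1 / (n : ℝ) ^ 2) / N ^ 2 * ∑ n ∈ S, ‖A n‖ ^ 2 := by
  have h1 : ∑ n ∈ S, ‖δ n‖ ^ 2 ≤ M ^ 2 * (∑' n : ℤ, 1 / (n : ℝ) ^ 2) / N ^ 2 := by
    calc ∑ n ∈ S, ‖δ n‖ ^ 2 ≤ ∑ n ∈ S, M ^ 2 / N ^ 2 * (1 / (n : ℝ) ^ 2) := by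
          refine Finset.sum_le_sum fun n hn => ?_
          have hn1 : N ^ 2 ≤ (n : ℝ) ^ 2 := by
            rw [← sq_abs (n : ℝ)]; exact pow_le_pow_left₀ hN.le (hS n hn) 2
          have hn2 : 0 < N ^ 2 := by positivity
          calc ‖δ n‖ ^ 2 ≤ (M / (n : ℝ) ^ 2) ^ 2 := by gcongr; exact hδ n hn
            _ = M ^ 2 / (n : ℝ) ^ 2 * (1 / (n : ℝ) ^ 2) := by ring
            _ ≤ _ := by gcongr
      _ = M ^ 2 / N ^ 2 * ∑ n ∈ S, 1 / (n : ℝ) ^ 2 := (Finset.mul_sum _ _ _).symm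
      _ ≤ M ^ 2 / N ^ 2 * ∑' n : ℤ, 1 / (n : ℝ) ^ 2 := by
          gcongr
          exact summable_int_inv_sq.sum_le_tsum S fun j _ => by positivity
      _ = _ := by ring
  calc ‖∑ n ∈ S, A n * δ n‖ ^ 2 ≤ (∑ n ∈ S, ‖A n‖ * ‖δ n‖) ^ 2 := by
        gcongr
        exact (norm_sum_le _ _).trans (Finset.sum_le_sum fun n _ => (norm_mul _ _).le)
    _ ≤ (∑ n ∈ S, ‖A n‖ ^ 2) * ∑ n ∈ S, ‖δ n‖ ^ 2 := Finset.sum_mul_sq_le_sq_mul_sq _ _ _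
    _ ≤ (∑ n ∈ S, ‖A n‖ ^ 2) * (M ^ 2 * (∑' n : ℤ, 1 / (n : ℝ) ^ 2) / N ^ 2) := by gcongr
    _ = _ := by ring

theorem norm_exp_hyperbolic_sub_le {z : ℤ → ℂ} {ω u K : ℝ} (hω : 0 ≤ ω)
    (hz : ∀ n : ℤ, n ≠ 0 → ‖z n - (-(ω : ℂ) + Complex.I * (u * n : ℝ))‖ ≤ K / (n : ℝ) ^ 2)
    (hre : ∀ n : ℤ, n ≠ 0 → (z n).re ≤ 0) {n : ℤ} (hn : n ≠ 0) {s : ℝ} (hs : 0 ≤ s) :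
    ‖Complex.exp (z n * s) - Complex.exp (-(ω * s : ℝ)) * Complex.exp (Complex.I * (u * n : ℝ) * s)‖
      ≤ K * s / (n : ℝ) ^ 2 := by
  rw [← Complex.exp_add]
  have e : (-((ω * s : ℝ) : ℂ)) + Complex.I * (u * n : ℝ) * s
      = (-(ω : ℂ) + Complex.I * (u * n : ℝ)) * s := by push_cast; ring
  rw [e]
  refine (norm_exp_sub_exp_le ?_ ?_).trans ?_
  · rw [Complex.re_mul_ofReal]; exact mul_nonpos_of_nonpos_of_nonneg (hre n hn) hs
  · rw [Complex.re_mul_ofReal]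
    refine mul_nonpos_of_nonpos_of_nonneg ?_ hs
    simpa using hω
  · rw [← sub_mul, norm_mul, Complex.norm_real, Real.norm_of_nonneg hs]
    calc _ ≤ K / (n : ℝ) ^ 2 * s := by gcongr; exact hz n hn
      _ = _ := by ring

theorem norm_expSum_hyperbolic_sub_sq_le {z : ℤ → ℂ} {ω u K N : ℝ} (hω : 0 ≤ ω)
    (hz : ∀ n : ℤ, n ≠ 0 → ‖z n - (-(ω : ℂ) + Complex.I * (u * n : ℝ))‖ ≤ K / (n : ℝ) ^ 2)
    (hre : ∀ n : ℤ, n ≠ 0 → (z n).re ≤ 0) (hN : 0 < N) (S : Finset ℤ)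
    (hS : ∀ n ∈ S, N ≤ |(n : ℝ)|) (A : ℤ → ℂ) {s : ℝ} (hs : 0 ≤ s) :
    ‖expSum z S A s - Complex.exp (-(ω * s : ℝ))
        * expSum (fun n : ℤ => Complex.I * (u * n : ℝ)) S A s‖ ^ 2
      ≤ (K * s) ^ 2 * (∑' n : ℤ, 1 / (n : ℝ) ^ 2) / N ^ 2 * ∑ n ∈ S, ‖A n‖ ^ 2 := by
  refine le_trans (le_of_eq ?_) (norm_sum_mul_sq_le_of_decay hN S hS A (fun n =>
    Complex.exp (z n * s) - Complex.exp (-(ω * s : ℝ)) * Complex.exp (Complex.I * (u * n : ℝ) * s))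
    fun n hn => norm_exp_hyperbolic_sub_le hω hz hre ?_ hs)
  · congr 2
    simp only [expSum, Finset.mul_sum, ← Finset.sum_sub_distrib]
    exact Finset.sum_congr rfl fun n _ => by ring
  · rintro rfl
    have := hS 0 hn
    simp at this
    linarith

theorem hyperbolic_direct {z : ℤ → ℂ} {ω u K : ℝ} (hω : 0 ≤ ω) (hu : 0 < u)
    (hz : ∀ n : ℤ, n ≠ 0 → ‖z n - (-(ω : ℂ) + Complex.I * (u * n : ℝ))‖ ≤ K / (n : ℝ) ^ 2)
    (hre : ∀ n : ℤ, n ≠ 0 → (z n).re ≤ 0) {a b : ℝ} (ha : 0 ≤ a) (hab : a ≤ b) :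
    ∃ D ≥ 0, ∀ S : Finset ℤ, (∀ n ∈ S, n ≠ 0) → ∀ A : ℤ → ℂ,
      ∫ s in a..b, ‖expSum z S A s‖ ^ 2 ≤ D * ∑ n ∈ S, ‖A n‖ ^ 2 := by
  obtain ⟨m, hm⟩ : ∃ m : ℕ, b ≤ a + m * (2 * Real.pi / u) := by
    obtain ⟨m, hm⟩ := exists_nat_ge ((b - a) / (2 * Real.pi / u))
    refine ⟨m, ?_⟩
    rw [div_le_iff₀ (by positivity)] at hm
    linarith
  set Z := ∑' n : ℤ, 1 / (n : ℝ) ^ 2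
  have hZ : 0 ≤ Z := tsum_nonneg fun n => by positivity
  have hba : 0 ≤ b - a := by linarith
  refine ⟨2 * ((b - a) * ((K * b) ^ 2 * Z)) + 2 * (m * (2 * Real.pi / u)),
    by positivity, fun S hS A => ?_⟩
  have hS1 : ∀ n ∈ S, (1 : ℝ) ≤ |(n : ℝ)| := fun n hn => by
    exact_mod_cast Int.one_le_abs (hS n hn)
  set f := expSum (fun n : ℤ => Complex.I * (u * n : ℝ)) S A with hf
  have hfc : Continuous f := continuous_expSum _ _ _
  have hec := continuous_expSum z S A
  have hs := integral_norm_add_sq_le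
    (f := fun s => expSum z S A s - Complex.exp (-(ω * s : ℝ)) * f s)
    (g := fun s => Complex.exp (-(ω * s : ℝ)) * f s) (by fun_prop) (by fun_prop) hab
  simp only [sub_add_cancel] at hs
  have h1 : ∫ s in a..b, ‖expSum z S A s - Complex.exp (-(ω * s : ℝ)) * f s‖ ^ 2
      ≤ (b - a) * ((K * b) ^ 2 * Z * ∑ n ∈ S, ‖A n‖ ^ 2) := by
    calc _ ≤ ∫ s in a..b, (K * b) ^ 2 * Z * ∑ n ∈ S, ‖A n‖ ^ 2 := by
          refine intervalIntegral.integral_mono_on hab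
            (Continuous.intervalIntegrable (by fun_prop) _ _) (by simp) fun s hs => ?_
          refine (norm_expSum_hyperbolic_sub_sq_le hω hz hre one_pos S hS1 A
            (ha.trans hs.1)).trans ?_
          rw [one_pow, div_one, mul_pow, mul_pow]
          have := hs.2
          have := ha.trans hs.1
          gcongr
      _ = _ := by simp; ring
  have h2 : ∫ s in a..b, ‖Complex.exp (-(ω * s : ℝ)) * f s‖ ^ 2
      ≤ m * (2 * Real.pi / u) * ∑ n ∈ S, ‖A n‖ ^ 2 := by
    rw [← integral_norm_fourier_sq hu S A a m]
    refine le_trans ?_ (integral_norm_sq_mono hfc le_rfl hab hm)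
    refine intervalIntegral.integral_mono_on hab
      (Continuous.intervalIntegrable (by fun_prop) _ _)
      (Continuous.intervalIntegrable (by fun_prop) _ _) fun s hs => ?_
    rw [norm_mul, ← Complex.ofReal_neg, Complex.norm_exp_ofReal]
    have : Real.exp (-(ω * s)) ≤ 1 :=
      Real.exp_le_one_iff.2 (neg_nonpos.2 (mul_nonneg hω (ha.trans hs.1)))
    have h0 : Real.exp (-(ω * s)) * ‖f s‖ ≤ 1 * ‖f s‖ := by gcongr
    rw [one_mul] at h0
    gcongr
  linarith

end Hyperbolic

theorem parabolic_direct {z : ℤ → ℂ} {μ u K : ℝ} (hμ : 0 < μ) (hK : 0 ≤ K)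
    (hz : ∀ j : ℤ, j ≠ 0 → ‖z j - (-(μ * (j : ℝ) ^ 2 : ℝ) + Complex.I * (u * j : ℝ))‖ ≤ K)
    {τ' a b : ℝ} (ha : τ' < a) (hab : a ≤ b) :
    ∃ D ≥ 0, ∀ S : Finset ℤ, (∀ n ∈ S, n ≠ 0) → ∀ x : ℤ → ℂ,
      ∫ s in a..b, ‖expSum z S x s‖ ^ 2
        ≤ D * ∑ n ∈ S, Real.exp (2 * (z n).re * τ') * ‖x n‖ ^ 2 := by
  have hsumm := summable_int_exp_neg_sq (show 0 < 2 * μ * (a - τ') by nlinarith)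
  set G := ∑' j : ℤ, Real.exp (-(2 * μ * (a - τ') * (j : ℝ) ^ 2))
  have hG : 0 ≤ G := tsum_nonneg fun n => (Real.exp_pos _).le
  have hba : 0 ≤ b - a := by linarith
  refine ⟨(b - a) * (Real.exp (2 * K * (b - τ')) * G), by positivity, fun S hS x => ?_⟩
  set X := ∑ n ∈ S, Real.exp (2 * (z n).re * τ') * ‖x n‖ ^ 2 with hX
  have hc := continuous_expSum z S x
  calc ∫ s in a..b, ‖expSum z S x s‖ ^ 2
      ≤ ∫ s in a..b, Real.exp (2 * K * (b - τ')) * G * X := by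
        refine intervalIntegral.integral_mono_on hab
          (Continuous.intervalIntegrable (by fun_prop) _ _) (by simp) fun s hs => ?_
        have h1 : ‖expSum z S x s‖ ≤ ∑ n ∈ S,
            (Real.exp ((z n).re * τ') * ‖x n‖) * Real.exp ((z n).re * (s - τ')) := by
          refine (norm_sum_le _ _).trans (Finset.sum_le_sum fun n _ => le_of_eq ?_)
          rw [norm_mul, Complex.norm_exp, Complex.re_mul_ofReal, mul_right_comm, ← Real.exp_add]
          rw [mul_comm]
          congr 2
          ring
        calc ‖expSum z S x s‖ ^ 2
            ≤ (∑ n ∈ S, (Real.exp ((z n).re * τ') * ‖x n‖) * Real.exp ((z n).re * (s - τ'))) ^ 2 := by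
              gcongr
          _ ≤ (∑ n ∈ S, (Real.exp ((z n).re * τ') * ‖x n‖) ^ 2)
              * ∑ n ∈ S, Real.exp ((z n).re * (s - τ')) ^ 2 :=
              Finset.sum_mul_sq_le_sq_mul_sq _ _ _
          _ = X * ∑ n ∈ S, Real.exp ((z n).re * (s - τ')) ^ 2 := by
              rw [hX]
              congr 1
              refine Finset.sum_congr rfl fun n _ => ?_
              rw [mul_pow, ← Real.exp_nat_mul]
              congr 2
              push_cast
              ring
          _ ≤ X * (Real.exp (2 * K * (b - τ')) * G) := by
              gcongr
              calc ∑ n ∈ S, Real.exp ((z n).re * (s - τ')) ^ 2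
                  ≤ ∑ n ∈ S, Real.exp (2 * K * (b - τ'))
                    * Real.exp (-(2 * μ * (a - τ') * (n : ℝ) ^ 2)) := by
                    refine Finset.sum_le_sum fun n hn => ?_
                    rw [← Real.exp_nat_mul, ← Real.exp_add, Real.exp_le_exp]
                    have h2 := (abs_le.1 (parabolic_re_im hz (hS n hn)).1).2
                    have h3 : (z n).re * (s - τ') ≤ (K - μ * (n : ℝ) ^ 2) * (s - τ') :=
                      mul_le_mul_of_nonneg_right (by linarith) (by linarith [hs.1])
                    have h4 : K * (s - τ') ≤ K * (b - τ') :=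
                      mul_le_mul_of_nonneg_left (by linarith [hs.2]) hK
                    have h5 : μ * (n : ℝ) ^ 2 * (a - τ') ≤ μ * (n : ℝ) ^ 2 * (s - τ') :=
                      mul_le_mul_of_nonneg_left (by linarith [hs.1]) (by positivity)
                    push_cast
                    linarith
                _ = Real.exp (2 * K * (b - τ'))
                    * ∑ n ∈ S, Real.exp (-(2 * μ * (a - τ') * (n : ℝ) ^ 2)) :=
                    (Finset.mul_sum _ _ _).symm
                _ ≤ _ := by
                    gcongr
                    exact hsumm.sum_le_tsum S fun j _ => (Real.exp_pos _).le
          _ = _ := by ring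
    _ = _ := by simp; ring

section HighFrequency

theorem two_le_exp_one : (2 : ℝ) ≤ Real.exp 1 := by
  have := Real.add_one_le_exp (1 : ℝ)
  linarith

theorem parabolic_part_le {zh zp : ℤ → ℂ} {ω u μ K : ℝ} (hω : 0 ≤ ω) (hu : 0 < u) (hμ : 0 < μ)
    (hK : 0 ≤ K)
    (hzh : ∀ n : ℤ, n ≠ 0 → ‖zh n - (-(ω : ℂ) + Complex.I * (u * n : ℝ))‖ ≤ K / (n : ℝ) ^ 2)
    (hre : ∀ n : ℤ, n ≠ 0 → (zh n).re ≤ 0)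
    (hzp : ∀ j : ℤ, j ≠ 0 → ‖zp j - (-(μ * (j : ℝ) ^ 2 : ℝ) + Complex.I * (u * j : ℝ))‖ ≤ K)
    {τ τ' : ℝ} (hτ : 0 < τ) (hτ' : 0 < τ') :
    ∃ N₀ ≥ (1 : ℝ), ∃ C > 0, ∀ N ≥ N₀, ∀ Sh Sp : Finset ℤ, (∀ n ∈ Sh, N < |(n : ℝ)|) →
      (∀ n ∈ Sp, N < |(n : ℝ)|) → ∀ A x : ℤ → ℂ,
      ∑ n ∈ Sp, Real.exp (2 * (zp n).re * τ') * ‖x n‖ ^ 2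
        ≤ C * ((∫ s in (0 : ℝ)..(τ + 2 * Real.pi / u), ‖expSum zh Sh A s + expSum zp Sp x s‖ ^ 2)
          + (∑ n ∈ Sh, ‖A n‖ ^ 2) / N ^ 2) := by
  set P := 2 * Real.pi / u with hP
  have hP0 : 0 < P := by positivity
  set N₀ := max 1 (max (4 * K / μ) (max (2 * K / u) ((K + ω + 1 / P) / μ))) with hN₀
  have hN1 : 1 ≤ N₀ := le_max_left _ _
  have hNμ : 4 * K ≤ μ * N₀ := by
    rw [← div_le_iff₀' hμ]
    exact (le_max_left _ _).trans (le_max_right _ _)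
  have hNu : 2 * K ≤ u * N₀ := by
    rw [← div_le_iff₀' hu]
    exact (le_max_left _ _).trans ((le_max_right _ _).trans (le_max_right _ _))
  have hNω : K + ω + 1 / P ≤ μ * N₀ := by
    rw [← div_le_iff₀' hμ]
    exact (le_max_right _ _).trans ((le_max_right _ _).trans (le_max_right _ _))
  obtain ⟨C₁, hC₁, hobs⟩ := parabolic_observability hμ hu hK hzp hN1 hNμ hNu hτ hτ'
  set Z := ∑' n : ℤ, 1 / (n : ℝ) ^ 2
  have hZ : 0 ≤ Z := tsum_nonneg fun n => by positivity
  set E := Real.exp (-(ω * P)) with hE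
  have hE0 : 0 < E := Real.exp_pos _
  have hE1 : E ≤ 1 := Real.exp_le_one_iff.2 (neg_nonpos.2 (mul_nonneg hω hP0.le))
  have hcE : Complex.exp (-(ω * P : ℝ)) = (E : ℂ) := by
    rw [hE, ← Complex.ofReal_neg, Complex.ofReal_exp]
  refine ⟨N₀, hN1, C₁ * (8 + 2 * (τ * ((K * P) ^ 2 * Z))) / (E / 2) ^ 2, by positivity,
    fun N hN Sh Sp hSh hSp A x => ?_⟩
  have hNpos : 0 < N := by linarith
  have hne : ∀ n : ℤ, N < |(n : ℝ)| → n ≠ 0 := by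
    rintro n hn rfl
    simp at hn
    linarith
  set F : ℝ → ℂ := fun s => expSum zh Sh A s + expSum zp Sp x s with hF
  have hFc : Continuous F := (continuous_expSum _ _ _).add (continuous_expSum _ _ _)
  set R := expSum zh Sh (fun n => A n * (Complex.exp (zh n * P) - E)) with hR
  set Q := expSum zp Sp (fun n => x n * (Complex.exp (zp n * P) - E)) with hQ
  have hRc : Continuous R := continuous_expSum _ _ _
  have hQs : ∀ s, Q s = (F (s + P) - E * F s) + -R s := by
    intro s
    simp only [hQ, hR, hF, ← expSum_add_sub]
    ring
  set X := ∑ n ∈ Sh, ‖A n‖ ^ 2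
  have hX : 0 ≤ X := Finset.sum_nonneg fun n _ => by positivity
  set I := ∫ s in (0 : ℝ)..(τ + P), ‖F s‖ ^ 2
  have hI : 0 ≤ I := integral_norm_sq_nonneg _ (by linarith)
  have hRle : ∫ s in (0 : ℝ)..τ, ‖-R s‖ ^ 2 ≤ τ * ((K * P) ^ 2 * Z / N ^ 2 * X) := by
    calc ∫ s in (0 : ℝ)..τ, ‖-R s‖ ^ 2 ≤ ∫ s in (0 : ℝ)..τ, (K * P) ^ 2 * Z / N ^ 2 * X := by
          refine intervalIntegral.integral_mono_on hτ.le
            (Continuous.intervalIntegrable (by fun_prop) _ _) (by simp) fun s hs => ?_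
          rw [norm_neg]
          refine le_trans (le_of_eq ?_) (norm_sum_mul_sq_le_of_decay hNpos Sh
            (fun n hn => (hSh n hn).le) A
            (fun n => (Complex.exp (zh n * P) - E) * Complex.exp (zh n * s)) fun n hn => ?_)
          · simp only [hR, expSum, mul_assoc]
          · have hn0 := hne n (hSh n hn)
            have h1 := norm_exp_hyperbolic_sub_le hω hzh hre hn0 hP0.le
            have h2 : Complex.exp (Complex.I * (u * n : ℝ) * P) = 1 := by
              rw [Complex.exp_eq_one_iff]
              refine ⟨n, ?_⟩
              have : (u : ℂ) ≠ 0 := by exact_mod_cast hu.ne'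
              rw [hP]
              push_cast
              field_simp
            rw [h2, mul_one, hcE] at h1
            have h3 : ‖Complex.exp (zh n * s)‖ ≤ 1 := by
              rw [Complex.norm_exp, Complex.re_mul_ofReal]
              exact Real.exp_le_one_iff.2 (mul_nonpos_of_nonpos_of_nonneg (hre n hn0) hs.1)
            rw [norm_mul]
            exact (mul_le_of_le_one_right (norm_nonneg _) h3).trans h1
      _ = _ := by simp; ring
  have hGle : ∫ s in (0 : ℝ)..τ, ‖F (s + P) - E * F s‖ ^ 2 ≤ 4 * I := by
    refine (integral_norm_shift_sub_le hFc hτ.le hP0.le (E : ℂ)).trans ?_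
    have : (1 + ‖(E : ℂ)‖) ^ 2 ≤ 4 := by
      rw [Complex.norm_real, Real.norm_of_nonneg hE0.le]
      nlinarith
    gcongr
  have hQle : ∫ s in (0 : ℝ)..τ, ‖Q s‖ ^ 2 ≤ 2 * (4 * I) + 2 * (τ * ((K * P) ^ 2 * Z / N ^ 2 * X)) := by
    simp only [hQs]
    refine (integral_norm_add_sq_le (by fun_prop) (by fun_prop) hτ.le).trans ?_
    gcongr
  have hκ : ∀ n ∈ Sp, E / 2 ≤ ‖Complex.exp (zp n * P) - E‖ := by
    intro n hn
    have hn0 := hne n (hSp n hn)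
    have h1 := (abs_le.1 (parabolic_re_im hzp hn0).1).2
    have h2 : N₀ ≤ (n : ℝ) ^ 2 := by
      rw [← sq_abs]
      nlinarith [hSp n hn]
    have h3 : (zp n).re ≤ -(ω + 1 / P) := by nlinarith
    have h4 : ‖Complex.exp (zp n * P)‖ ≤ E / 2 := by
      rw [Complex.norm_exp, Complex.re_mul_ofReal]
      have h5 : (zp n).re * P ≤ -(ω * P) - 1 := by
        calc (zp n).re * P ≤ -(ω + 1 / P) * P := by gcongr
          _ = _ := by field_simp; ring
      calc Real.exp ((zp n).re * P) ≤ Real.exp (-(ω * P) - 1) := Real.exp_le_exp.2 h5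
        _ = E / Real.exp 1 := Real.exp_sub _ _
        _ ≤ E / 2 := by gcongr; exact two_le_exp_one
    have h6 := norm_sub_norm_le (E : ℂ) (Complex.exp (zp n * P))
    rw [Complex.norm_real, Real.norm_of_nonneg hE0.le, norm_sub_rev] at h6
    linarith
  have hmain := hobs Sp (fun n hn => hN.trans_lt (hSp n hn))
    (fun n => x n * (Complex.exp (zp n * P) - E))
  have hlow : (E / 2) ^ 2 * ∑ n ∈ Sp, Real.exp (2 * (zp n).re * τ') * ‖x n‖ ^ 2
      ≤ ∑ n ∈ Sp, Real.exp (2 * (zp n).re * τ')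
        * ‖x n * (Complex.exp (zp n * P) - E)‖ ^ 2 := by
    rw [Finset.mul_sum]
    refine Finset.sum_le_sum fun n hn => ?_
    rw [norm_mul, mul_pow]
    calc _ = Real.exp (2 * (zp n).re * τ') * (‖x n‖ ^ 2 * (E / 2) ^ 2) := by ring
      _ ≤ _ := by
        have := hκ n hn
        gcongr
  rw [div_mul_eq_mul_div, le_div_iff₀ (by positivity), mul_comm]
  calc _ ≤ C₁ * (2 * (4 * I) + 2 * (τ * ((K * P) ^ 2 * Z / N ^ 2 * X))) :=
        hlow.trans (hmain.trans (by gcongr))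
    _ = C₁ * (8 * I + 2 * (τ * ((K * P) ^ 2 * Z)) * (X / N ^ 2)) := by ring
    _ ≤ C₁ * ((8 + 2 * (τ * ((K * P) ^ 2 * Z))) * (I + X / N ^ 2)) := by
        have h1 : 0 ≤ 2 * (τ * ((K * P) ^ 2 * Z)) := by positivity
        have h2 : 0 ≤ X / N ^ 2 := by positivity
        gcongr
        nlinarith [mul_nonneg h1 hI]
    _ = _ := by ring

theorem hyperbolic_part_le {zh zp : ℤ → ℂ} {ω u μ K : ℝ} (hω : 0 ≤ ω) (hu : 0 < u) (hμ : 0 < μ)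
    (hK : 0 ≤ K)
    (hzh : ∀ n : ℤ, n ≠ 0 → ‖zh n - (-(ω : ℂ) + Complex.I * (u * n : ℝ))‖ ≤ K / (n : ℝ) ^ 2)
    (hre : ∀ n : ℤ, n ≠ 0 → (zh n).re ≤ 0)
    (hzp : ∀ j : ℤ, j ≠ 0 → ‖zp j - (-(μ * (j : ℝ) ^ 2 : ℝ) + Complex.I * (u * j : ℝ))‖ ≤ K)
    {τ τ' : ℝ} (hτ' : 0 < τ') (hτ : τ' < τ) :
    ∃ C > 0, ∀ N ≥ (1 : ℝ), ∀ Sh Sp : Finset ℤ, (∀ n ∈ Sh, N < |(n : ℝ)|) →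
      (∀ n ∈ Sp, N < |(n : ℝ)|) → ∀ A x : ℤ → ℂ,
      ∑ n ∈ Sh, ‖A n‖ ^ 2
        ≤ C * ((∫ s in (0 : ℝ)..(τ + 2 * Real.pi / u), ‖expSum zh Sh A s + expSum zp Sp x s‖ ^ 2)
          + (∑ n ∈ Sp, Real.exp (2 * (zp n).re * τ') * ‖x n‖ ^ 2)
          + (∑ n ∈ Sh, ‖A n‖ ^ 2) / N ^ 2) := by
  set P := 2 * Real.pi / u with hP
  have hP0 : 0 < P := by positivity
  have hτP : τ ≤ τ + P := by linarith
  have hT0 : 0 ≤ τ + P := by linarith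
  obtain ⟨D, hD, hdir⟩ := parabolic_direct hμ hK hzp hτ hτP
  set Z := ∑' n : ℤ, 1 / (n : ℝ) ^ 2
  have hZ : 0 ≤ Z := tsum_nonneg fun n => by positivity
  set M := Real.exp (ω * (τ + P)) ^ 2 / P
  have hM : 0 < M := by positivity
  refine ⟨M * (2 + 4 * D + 4 * (P * ((K * (τ + P)) ^ 2 * Z))), by positivity,
    fun N hN Sh Sp hSh hSp A x => ?_⟩
  have hNpos : 0 < N := by linarith
  set f := expSum (fun n : ℤ => Complex.I * (u * n : ℝ)) Sh A with hf
  have hfc : Continuous f := continuous_expSum _ _ _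
  have hhc := continuous_expSum zh Sh A
  have hpc := continuous_expSum zp Sp x
  set F : ℝ → ℂ := fun s => expSum zh Sh A s + expSum zp Sp x s with hF
  have hFc : Continuous F := hhc.add hpc
  set X := ∑ n ∈ Sh, ‖A n‖ ^ 2 with hXdef
  have hX : 0 ≤ X := Finset.sum_nonneg fun n _ => by positivity
  set Y := ∑ n ∈ Sp, Real.exp (2 * (zp n).re * τ') * ‖x n‖ ^ 2
  have hY : 0 ≤ Y := Finset.sum_nonneg fun n _ => by positivity
  set I := ∫ s in (0 : ℝ)..(τ + P), ‖F s‖ ^ 2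
  have hI : 0 ≤ I := integral_norm_sq_nonneg _ hT0
  have hper : P * X = ∫ s in τ..(τ + P), ‖f s‖ ^ 2 := by
    have := integral_norm_fourier_sq hu Sh A τ 1
    rw [Nat.cast_one, one_mul] at this
    exact this.symm
  set pert : ℝ → ℂ := fun s => expSum zh Sh A s - Complex.exp (-(ω * s : ℝ)) * f s with hpert
  have hpertc : Continuous pert := by fun_prop
  have hpertle : ∫ s in τ..(τ + P), ‖pert s‖ ^ 2
      ≤ P * ((K * (τ + P)) ^ 2 * Z / N ^ 2 * X) := by
    calc _ ≤ ∫ s in τ..(τ + P), (K * (τ + P)) ^ 2 * Z / N ^ 2 * X := by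
          refine intervalIntegral.integral_mono_on hτP
            (Continuous.intervalIntegrable (by fun_prop) _ _) (by simp) fun s hs => ?_
          have hs0 : 0 ≤ s := by linarith [hs.1]
          refine (norm_expSum_hyperbolic_sub_sq_le hω hzh hre hNpos Sh
            (fun n hn => (hSh n hn).le) A hs0).trans ?_
          have := hs.2
          gcongr
      _ = _ := by simp; ring
  have hne : ∀ n ∈ Sp, n ≠ 0 := by
    rintro n hn rfl
    have := hSp 0 hn
    simp at this
    linarith
  have hpar : ∫ s in τ..(τ + P), ‖expSum zp Sp x s‖ ^ 2 ≤ D * Y := hdir Sp hne x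
  have hFle : ∫ s in τ..(τ + P), ‖F s‖ ^ 2 ≤ I :=
    integral_norm_sq_mono hFc (by linarith) hτP le_rfl
  have hdamp : ∫ s in τ..(τ + P), ‖Complex.exp (-(ω * s : ℝ)) * f s‖ ^ 2
      ≤ 2 * I + 4 * (D * Y) + 4 * (P * ((K * (τ + P)) ^ 2 * Z / N ^ 2 * X)) := by
    have e : ∀ s : ℝ, Complex.exp (-(ω * s : ℝ)) * f s
        = F s + (-expSum zp Sp x s + -pert s) := by
      intro s
      simp only [hF, hpert]
      ring
    simp only [e]
    have h1 := integral_norm_add_sq_le (f := F) (g := fun s => -expSum zp Sp x s + -pert s)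
      hFc (by fun_prop) hτP
    have h2 := integral_norm_add_sq_le (f := fun s => -expSum zp Sp x s) (g := fun s => -pert s)
      (by fun_prop) (by fun_prop) hτP
    simp only [norm_neg] at h2
    linarith
  have hundamp : ∫ s in τ..(τ + P), ‖f s‖ ^ 2
      ≤ Real.exp (ω * (τ + P)) ^ 2 * ∫ s in τ..(τ + P), ‖Complex.exp (-(ω * s : ℝ)) * f s‖ ^ 2 := by
    rw [← intervalIntegral.integral_const_mul]
    refine intervalIntegral.integral_mono_on hτP
      (Continuous.intervalIntegrable (by fun_prop) _ _)
      (Continuous.intervalIntegrable (by fun_prop) _ _) fun s hs => ?_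
    rw [norm_mul, ← Complex.ofReal_neg, Complex.norm_exp_ofReal, ← mul_pow, ← mul_assoc,
      ← Real.exp_add]
    have h1 : 1 ≤ Real.exp (ω * (τ + P) + -(ω * s)) :=
      Real.one_le_exp_iff.2 (by nlinarith [hs.2])
    gcongr
    exact le_mul_of_one_le_left (norm_nonneg _) h1
  have hXle : X ≤ M * (2 * I + 4 * (D * Y) + 4 * (P * ((K * (τ + P)) ^ 2 * Z / N ^ 2 * X))) := by
    rw [div_mul_eq_mul_div, le_div_iff₀ hP0, mul_comm X P, hper]
    exact hundamp.trans (by gcongr)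
  refine hXle.trans ?_
  rw [mul_assoc]
  refine mul_le_mul_of_nonneg_left ?_ hM.le
  have h1 : 0 ≤ P * ((K * (τ + P)) ^ 2 * Z) := by positivity
  have h2 : 0 ≤ X / N ^ 2 := by positivity
  have h3 : P * ((K * (τ + P)) ^ 2 * Z / N ^ 2 * X)
      = P * ((K * (τ + P)) ^ 2 * Z) * (X / N ^ 2) := by ring
  rw [h3]
  nlinarith [mul_nonneg h1 hI, mul_nonneg h1 hY, mul_nonneg hD hI, mul_nonneg hD h2]

theorem high_frequency_observability {zh zp : ℤ → ℂ} {ω u μ K : ℝ} (hω : 0 ≤ ω) (hu : 0 < u)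
    (hμ : 0 < μ) (hK : 0 ≤ K)
    (hzh : ∀ n : ℤ, n ≠ 0 → ‖zh n - (-(ω : ℂ) + Complex.I * (u * n : ℝ))‖ ≤ K / (n : ℝ) ^ 2)
    (hre : ∀ n : ℤ, n ≠ 0 → (zh n).re ≤ 0)
    (hzp : ∀ j : ℤ, j ≠ 0 → ‖zp j - (-(μ * (j : ℝ) ^ 2 : ℝ) + Complex.I * (u * j : ℝ))‖ ≤ K)
    {τ τ' : ℝ} (hτ' : 0 < τ') (hτ : τ' < τ) :
    ∃ N ≥ (1 : ℝ), ∃ C > 0, ∀ Sh Sp : Finset ℤ, (∀ n ∈ Sh, N < |(n : ℝ)|) →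
      (∀ n ∈ Sp, N < |(n : ℝ)|) → ∀ A x : ℤ → ℂ,
      ∑ n ∈ Sh, ‖A n‖ ^ 2 + ∑ n ∈ Sp, Real.exp (2 * (zp n).re * τ') * ‖x n‖ ^ 2
        ≤ C * ∫ s in (0 : ℝ)..(τ + 2 * Real.pi / u),
          ‖expSum zh Sh A s + expSum zp Sp x s‖ ^ 2 := by
  obtain ⟨N₀, hN₀, C₁, hC₁, h1⟩ :=
    parabolic_part_le hω hu hμ hK hzh hre hzp (hτ'.trans hτ) hτ'
  obtain ⟨C₂, hC₂, h2⟩ := hyperbolic_part_le hω hu hμ hK hzh hre hzp hτ' hτ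
  set L := C₂ * (1 + C₁)
  have hL : 0 < L := by positivity
  refine ⟨max N₀ (2 * L), le_max_of_le_left hN₀, 2 * L + C₁ * (1 + 2 * L), by positivity,
    fun Sh Sp hSh hSp A x => ?_⟩
  set N := max N₀ (2 * L)
  have hN1 : 1 ≤ N := le_max_of_le_left hN₀
  have k1 := h1 N (le_max_left _ _) Sh Sp hSh hSp A x
  have k2 := h2 N hN1 Sh Sp hSh hSp A x
  set X := ∑ n ∈ Sh, ‖A n‖ ^ 2
  have hX : 0 ≤ X := Finset.sum_nonneg fun n _ => by positivity
  set Y := ∑ n ∈ Sp, Real.exp (2 * (zp n).re * τ') * ‖x n‖ ^ 2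
  set I := ∫ s in (0 : ℝ)..(τ + 2 * Real.pi / u), ‖expSum zh Sh A s + expSum zp Sp x s‖ ^ 2
  set q := X / N ^ 2 with hq
  have hq0 : 0 ≤ q := by positivity
  have hqX : 2 * L * q ≤ X := by
    have hN2 : 2 * L ≤ N ^ 2 := by
      have : 2 * L ≤ N := le_max_right _ _
      nlinarith
    calc 2 * L * q ≤ N ^ 2 * q := by gcongr
      _ = X := by rw [hq]; field_simp
  have hqX' : q ≤ X := div_le_self hX (one_le_pow₀ hN1)
  have k3 : X ≤ L * (I + q) := by
    refine k2.trans ?_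
    have : C₂ * Y ≤ C₂ * (C₁ * (I + q)) := by gcongr
    simp only [L]
    linarith
  have k4 : X ≤ 2 * L * I := by linarith
  have k5 : C₁ * (I + q) ≤ C₁ * (I + 2 * L * I) := by gcongr; linarith
  linarith

end HighFrequency

section AddMode

/-- The exponential family `exp (z i * s)`, `i ∈ S`, satisfies an observability inequality on
`[0, T]` with weights `w`. -/
def IsObservable {ι : Type*} (z : ι → ℂ) (w : ι → ℝ) (S : Set ι) (T : ℝ) : Prop :=
  ∃ C > 0, ∀ S₀ : Finset ι, (∀ i ∈ S₀, i ∈ S) → ∀ x : ι → ℂ,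
    ∑ i ∈ S₀, w i * ‖x i‖ ^ 2 ≤ C * ∫ s in (0 : ℝ)..T, ‖expSum z S₀ x s‖ ^ 2

theorem integral_norm_exp_sub_exp_sq_pos {z a : ℂ} (hza : z ≠ a) {δ : ℝ} (hδ : 0 < δ) :
    0 < ∫ h in (0 : ℝ)..δ, ‖Complex.exp (z * h) - Complex.exp (a * h)‖ ^ 2 := by
  have hd : 0 < ‖a - z‖ := norm_pos_iff.2 (sub_ne_zero.2 hza.symm)
  set h := min δ (1 / (2 * ‖a - z‖)) with hh
  have hh0 : 0 < h := lt_min hδ (by positivity)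
  refine intervalIntegral.integral_pos hδ (by fun_prop) (fun s _ => by positivity)
    ⟨h, ⟨hh0.le, min_le_left _ _⟩, ?_⟩
  have hn : ‖a * h - z * h‖ = ‖a - z‖ * h := by
    rw [← sub_mul, norm_mul, Complex.norm_real, Real.norm_of_nonneg hh0.le]
  have hsmall : ‖a * h - z * h‖ ≤ 1 / 2 := by
    rw [hn]
    calc ‖a - z‖ * h ≤ ‖a - z‖ * (1 / (2 * ‖a - z‖)) := by gcongr; exact min_le_right _ _
      _ = 1 / 2 := by field_simp
  have h1 := norm_one_sub_exp_ge_norm hsmall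
  rw [hn] at h1
  have h2 : 0 < ‖a - z‖ * h := mul_pos hd hh0
  rw [norm_exp_sub_exp_eq]
  have : 0 < ‖1 - Complex.exp (a * h - z * h)‖ := by linarith
  positivity

theorem integral_norm_exp_sub_exp_sq_ge {z a : ℂ} (hz : z.re ≤ 0) (ha : a.re ≤ 0)
    (hza : ‖a‖ < ‖z‖) {δ : ℝ} (hδ : 0 < δ) :
    δ * Real.exp (2 * a.re * δ) - 4 / (‖z‖ - ‖a‖)
      ≤ ∫ h in (0 : ℝ)..δ, ‖Complex.exp (z * h) - Complex.exp (a * h)‖ ^ 2 := by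
  set q := z + (starRingEnd ℂ) a with hq
  have hqn : ‖z‖ - ‖a‖ ≤ ‖q‖ := by
    have := norm_sub_norm_le z (-(starRingEnd ℂ) a)
    simpa [hq] using this
  have hq0 : q ≠ 0 := norm_pos_iff.1 (lt_of_lt_of_le (sub_pos.2 hza) hqn)
  have hint : (∫ h in (0 : ℝ)..δ, (Complex.exp (q * h)).re) ≤ 2 / (‖z‖ - ‖a‖) := by
    have e : ∫ h in (0 : ℝ)..δ, (Complex.exp (q * h)).re
        = (∫ h in (0 : ℝ)..δ, Complex.exp (q * h)).re := by
      have := Complex.reCLM.intervalIntegral_comp_comm (a := 0) (b := δ)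
        (f := fun h : ℝ => Complex.exp (q * h)) (μ := MeasureTheory.volume)
        (Continuous.intervalIntegrable (by fun_prop) _ _)
      simpa using this
    rw [e, integral_exp_mul_complex hq0]
    refine (Complex.re_le_norm _).trans ?_
    rw [norm_div]
    have h1 : ‖Complex.exp (q * δ) - Complex.exp (q * (0 : ℝ))‖ ≤ 2 := by
      refine (norm_sub_le _ _).trans ?_
      have : ‖Complex.exp (q * δ)‖ ≤ 1 := by
        rw [Complex.norm_exp, Complex.re_mul_ofReal]
        refine Real.exp_le_one_iff.2 (mul_nonpos_of_nonpos_of_nonneg ?_ hδ.le)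
        simp only [hq, Complex.add_re, Complex.conj_re]
        linarith
      simp only [Complex.ofReal_zero, mul_zero, Complex.exp_zero, norm_one]
      linarith
    have := sub_pos.2 hza
    gcongr
  calc δ * Real.exp (2 * a.re * δ) - 4 / (‖z‖ - ‖a‖)
      ≤ (∫ h in (0 : ℝ)..δ, Real.exp (2 * a.re * δ))
        - 2 * ∫ h in (0 : ℝ)..δ, (Complex.exp (q * h)).re := by
        rw [intervalIntegral.integral_const, smul_eq_mul, sub_zero]
        have : 4 / (‖z‖ - ‖a‖) = 2 * (2 / (‖z‖ - ‖a‖)) := by ring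
        linarith
    _ = ∫ h in (0 : ℝ)..δ, (Real.exp (2 * a.re * δ) - 2 * (Complex.exp (q * h)).re) := by
        rw [intervalIntegral.integral_sub (by simp)
          (Continuous.intervalIntegrable (by fun_prop) _ _), intervalIntegral.integral_const_mul]
    _ ≤ _ := by
        refine intervalIntegral.integral_mono_on hδ.le
          (Continuous.intervalIntegrable (by fun_prop) _ _)
          (Continuous.intervalIntegrable (by fun_prop) _ _) fun h hh => ?_
        have h1 : Complex.exp (q * h)
            = Complex.exp (z * h) * (starRingEnd ℂ) (Complex.exp (a * h)) := by
          rw [← Complex.exp_conj, ← Complex.exp_add, hq]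
          simp only [map_mul, Complex.conj_ofReal]
          ring_nf
        have h2 : Real.exp (2 * a.re * δ) ≤ Complex.normSq (Complex.exp (a * h)) := by
          rw [Complex.normSq_eq_norm_sq, Complex.norm_exp, Complex.re_mul_ofReal,
            ← Real.exp_nat_mul, Real.exp_le_exp]
          push_cast
          nlinarith [hh.2]
        rw [← Complex.normSq_eq_norm_sq, Complex.normSq_sub, h1]
        linarith [Complex.normSq_nonneg (Complex.exp (z * h))]

theorem exists_pos_le_of_finite {ι : Type*} {S : Set ι} (hS : S.Finite) {g : ι → ℝ}
    (hg : ∀ i ∈ S, 0 < g i) : ∃ γ > 0, ∀ i ∈ S, γ ≤ g i := by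
  rcases S.eq_empty_or_nonempty with rfl | hne
  · exact ⟨1, one_pos, by simp⟩
  · obtain ⟨i, hi, hmin⟩ := Set.exists_min_image S g hS hne
    exact ⟨g i, hg i hi, hmin⟩

theorem exists_pos_le_integral_norm_exp_sub_exp_sq {ι : Type*} {z : ι → ℂ} {S : Set ι} {a : ℂ}
    (ha : a.re ≤ 0) (hre : ∀ i ∈ S, (z i).re ≤ 0) (hne : ∀ i ∈ S, z i ≠ a)
    (hfin : ∀ R : ℝ, {i ∈ S | ‖z i‖ ≤ R}.Finite) {δ : ℝ} (hδ : 0 < δ) :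
    ∃ γ > 0, ∀ i ∈ S,
      γ ≤ ∫ h in (0 : ℝ)..δ, ‖Complex.exp (z i * h) - Complex.exp (a * h)‖ ^ 2 := by
  set m := δ * Real.exp (2 * a.re * δ)
  have hm : 0 < m := by positivity
  obtain ⟨γ, hγ, hγS⟩ := exists_pos_le_of_finite (hfin (‖a‖ + 8 / m)) fun i hi =>
    integral_norm_exp_sub_exp_sq_pos (hne i hi.1) hδ
  refine ⟨min γ (m / 2), by positivity, fun i hi => ?_⟩
  rcases le_or_gt ‖z i‖ (‖a‖ + 8 / m) with h | h
  · exact (min_le_left _ _).trans (hγS i ⟨hi, h⟩)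
  · have h8 : 0 < 8 / m := by positivity
    refine (min_le_right _ _).trans (le_trans ?_
      (integral_norm_exp_sub_exp_sq_ge (hre i hi) ha (by linarith) hδ))
    have : 4 / (‖z i‖ - ‖a‖) ≤ 4 / (8 / m) := by
      gcongr
      linarith
    have e : 4 / (8 / m) = m / 2 := by field_simp; norm_num
    linarith

theorem sum_erase_le_of_isObservable {ι : Type*} {z : ι → ℂ} {w : ι → ℝ} {S : Set ι} {k : ι}
    {T' T : ℝ} (hT' : 0 < T') (hTT' : T' < T) (hk : (z k).re ≤ 0)
    (hre : ∀ i ∈ S, (z i).re ≤ 0) (hne : ∀ i ∈ S, z i ≠ z k)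
    (hfin : ∀ R : ℝ, {i ∈ S | ‖z i‖ ≤ R}.Finite) (hw : ∀ i, 0 ≤ w i)
    (hobs : IsObservable z w S T') :
    ∃ B > 0, ∀ S₀ : Finset ι, (∀ i ∈ S₀, i ∈ insert k S) → ∀ x : ι → ℂ,
      ∑ i ∈ S₀.erase k, w i * ‖x i‖ ^ 2 ≤ B * ∫ s in (0 : ℝ)..T, ‖expSum z S₀ x s‖ ^ 2 := by
  obtain ⟨C, hC, hobs⟩ := hobs
  have hδ : 0 < T - T' := sub_pos.2 hTT'
  obtain ⟨γ, hγ, hγS⟩ := exists_pos_le_integral_norm_exp_sub_exp_sq hk hre hne hfin hδ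
  refine ⟨(T - T') * (C * 4) / γ, by positivity, fun S₀ hS₀ x => ?_⟩
  have hS₁ : ∀ i ∈ S₀.erase k, i ∈ S := fun i hi =>
    (hS₀ i (Finset.mem_of_mem_erase hi)).resolve_left (Finset.ne_of_mem_erase hi)
  set I := ∫ s in (0 : ℝ)..T, ‖expSum z S₀ x s‖ ^ 2
  have hfc := continuous_expSum z S₀ x
  have hpt : ∀ h ∈ Set.Icc 0 (T - T'), ∑ i ∈ S₀.erase k,
      w i * ‖x i‖ ^ 2 * ‖Complex.exp (z i * h) - Complex.exp (z k * h)‖ ^ 2 ≤ C * 4 * I := by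
    intro h hh
    have h1 := hobs (S₀.erase k) hS₁
      (fun i => x i * (Complex.exp (z i * h) - Complex.exp (z k * h)))
    have h2 : ∀ s, expSum z (S₀.erase k)
        (fun i => x i * (Complex.exp (z i * h) - Complex.exp (z k * h))) s
        = expSum z S₀ x (s + h) - Complex.exp (z k * h) * expSum z S₀ x s := by
      intro s
      rw [expSum_add_sub]
      exact Finset.sum_erase _ (by simp)
    simp only [h2, norm_mul, mul_pow, ← mul_assoc] at h1
    refine h1.trans ?_
    rw [mul_assoc]
    refine mul_le_mul_of_nonneg_left ?_ hC.le
    refine (integral_norm_shift_sub_le hfc hT'.le hh.1 _).trans ?_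
    have h3 : ‖Complex.exp (z k * h)‖ ≤ 1 := by
      rw [Complex.norm_exp, Complex.re_mul_ofReal]
      exact Real.exp_le_one_iff.2 (mul_nonpos_of_nonpos_of_nonneg hk hh.1)
    have h4 : (1 + ‖Complex.exp (z k * h)‖) ^ 2 ≤ 4 := by
      nlinarith [norm_nonneg (Complex.exp (z k * h))]
    have h5 : ∫ s in (0 : ℝ)..(T' + h), ‖expSum z S₀ x s‖ ^ 2 ≤ I :=
      integral_norm_sq_mono hfc le_rfl (by linarith [hh.1]) (by linarith [hh.2])
    have h6 := integral_norm_sq_nonneg (expSum z S₀ x) (show 0 ≤ T' + h by linarith [hh.1])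
    gcongr
  rw [div_mul_eq_mul_div, le_div_iff₀ hγ, Finset.sum_mul]
  calc ∑ i ∈ S₀.erase k, w i * ‖x i‖ ^ 2 * γ
      ≤ ∑ i ∈ S₀.erase k, w i * ‖x i‖ ^ 2
        * ∫ h in (0 : ℝ)..(T - T'), ‖Complex.exp (z i * h) - Complex.exp (z k * h)‖ ^ 2 := by
        refine Finset.sum_le_sum fun i hi => ?_
        have := hγS i (hS₁ i hi)
        have := hw i
        gcongr
    _ = ∫ h in (0 : ℝ)..(T - T'), ∑ i ∈ S₀.erase k,
        w i * ‖x i‖ ^ 2 * ‖Complex.exp (z i * h) - Complex.exp (z k * h)‖ ^ 2 := by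
        rw [intervalIntegral.integral_finsetSum
          fun n _ => Continuous.intervalIntegrable (by fun_prop) _ _]
        simp only [intervalIntegral.integral_const_mul]
    _ ≤ ∫ h in (0 : ℝ)..(T - T'), C * 4 * I :=
        intervalIntegral.integral_mono_on hδ.le
          (Continuous.intervalIntegrable (by fun_prop) _ _) (by simp) hpt
    _ = _ := by simp; ring

theorem IsObservable.insert {ι : Type*} {z : ι → ℂ} {w : ι → ℝ} {S : Set ι} {k : ι}
    {T' T D : ℝ} (hobs : IsObservable z w S T') (hT' : 0 < T') (hTT' : T' < T)
    (hk : (z k).re ≤ 0) (hre : ∀ i ∈ S, (z i).re ≤ 0) (hne : ∀ i ∈ S, z i ≠ z k)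
    (hfin : ∀ R : ℝ, {i ∈ S | ‖z i‖ ≤ R}.Finite) (hw : ∀ i, 0 ≤ w i) (hD : 0 ≤ D)
    (hdir : ∀ S₀ : Finset ι, (∀ i ∈ S₀, i ∈ S) → ∀ x : ι → ℂ,
      ∫ s in T'..T, ‖expSum z S₀ x s‖ ^ 2 ≤ D * ∑ i ∈ S₀, w i * ‖x i‖ ^ 2) :
    IsObservable z w (insert k S) T := by
  obtain ⟨B, hB, hle⟩ := sum_erase_le_of_isObservable hT' hTT' hk hre hne hfin hw hobs
  set m := ∫ s in T'..T, ‖Complex.exp (z k * s)‖ ^ 2 with hm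
  have hm0 : 0 < m := by
    refine intervalIntegral.intervalIntegral_pos_of_pos
      (Continuous.intervalIntegrable (by fun_prop) _ _) (fun s => ?_) hTT'
    have := norm_pos_iff.2 (Complex.exp_ne_zero (z k * s))
    positivity
  have hwk := hw k
  refine ⟨B + w k * ((2 + 2 * (D * B)) / m), by positivity, fun S₀ hS₀ x => ?_⟩
  have hY := hle S₀ hS₀ x
  have hfc := continuous_expSum z S₀ x
  have hec := continuous_expSum z (S₀.erase k) x
  set I := ∫ s in (0 : ℝ)..T, ‖expSum z S₀ x s‖ ^ 2
  have hI : 0 ≤ I := integral_norm_sq_nonneg _ (hT'.trans hTT').le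
  by_cases hkS : k ∈ S₀
  · have hS₁ : ∀ i ∈ S₀.erase k, i ∈ S := fun i hi =>
      (hS₀ i (Finset.mem_of_mem_erase hi)).resolve_left (Finset.ne_of_mem_erase hi)
    have hxk : m * ‖x k‖ ^ 2 ≤ (2 + 2 * (D * B)) * I := by
      have h1 := integral_norm_add_sq_le hfc (g := fun s => -expSum z (S₀.erase k) x s)
        (by fun_prop) hTT'.le
      have h2 : ∀ s, expSum z S₀ x s + -expSum z (S₀.erase k) x s
          = x k * Complex.exp (z k * s) := by
        intro s
        simp only [expSum, ← Finset.add_sum_erase S₀ _ hkS]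
        ring
      simp only [h2, norm_mul, mul_pow, intervalIntegral.integral_const_mul,
        norm_neg] at h1
      have h3 : ∫ s in T'..T, ‖expSum z S₀ x s‖ ^ 2 ≤ I :=
        integral_norm_sq_mono hfc hT'.le hTT'.le le_rfl
      have h4 := (hdir _ hS₁ x).trans (mul_le_mul_of_nonneg_left hY hD)
      rw [mul_comm]
      linarith
    have hxk' : ‖x k‖ ^ 2 ≤ (2 + 2 * (D * B)) / m * I := by
      rw [div_mul_eq_mul_div, le_div_iff₀ hm0, mul_comm]
      exact hxk
    rw [← Finset.add_sum_erase S₀ _ hkS]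
    have := mul_le_mul_of_nonneg_left hxk' hwk
    linarith
  · rw [Finset.erase_eq_of_notMem hkS] at hY
    refine hY.trans (mul_le_mul_of_nonneg_right ?_ hI)
    have : 0 ≤ w k * ((2 + 2 * (D * B)) / m) := by positivity
    linarith

end AddMode

section Iterate

theorem IsObservable.union_finset {ι : Type*} {z : ι → ℂ} {w : ι → ℝ} {A S : Set ι} {T₁ : ℝ}
    (hobs : IsObservable z w S T₁) (hT₁ : 0 < T₁) (hSA : S ⊆ A) (hinj : Set.InjOn z A)
    (hre : ∀ i ∈ A, (z i).re ≤ 0) (hfin : ∀ R : ℝ, {i ∈ A | ‖z i‖ ≤ R}.Finite)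
    (hw : ∀ i, 0 ≤ w i)
    (hdir : ∀ a b : ℝ, T₁ < a → a ≤ b → ∃ D ≥ 0, ∀ S₀ : Finset ι, (∀ i ∈ S₀, i ∈ A) →
      ∀ x : ι → ℂ, ∫ s in a..b, ‖expSum z S₀ x s‖ ^ 2 ≤ D * ∑ i ∈ S₀, w i * ‖x i‖ ^ 2)
    (J : Finset ι) (hJ : ↑J ⊆ A) {T : ℝ} (hT : T₁ < T) :
    IsObservable z w (S ∪ J) T := by
  induction J using Finset.induction_on generalizing T with
  | empty =>
    obtain ⟨C, hC, h⟩ := hobs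
    refine ⟨C, hC, fun S₀ hS₀ x => (h S₀ (by simpa using hS₀) x).trans ?_⟩
    gcongr
    exact integral_norm_sq_mono (continuous_expSum z S₀ x) le_rfl hT₁.le hT.le
  | insert k J _ ih =>
    rw [Finset.coe_insert, Set.insert_subset_iff] at hJ
    have hSJ : S ∪ ↑J ⊆ A := Set.union_subset hSA hJ.2
    rw [Finset.coe_insert, Set.union_insert]
    by_cases hk : k ∈ S ∪ ↑J
    · rw [Set.insert_eq_of_mem hk]
      exact ih hJ.2 hT
    · obtain ⟨D, hD, hdir⟩ := hdir ((T₁ + T) / 2) T (by linarith) (by linarith)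
      refine (ih hJ.2 (T := (T₁ + T) / 2) (by linarith)).insert (by linarith) (by linarith)
        (hre k hJ.1) (fun i hi => hre i (hSJ hi)) (fun i hi h => ?_)
        (fun R => (hfin R).subset fun i hi => ⟨hSJ hi.1, hi.2⟩) hw hD
        fun S₀ hS₀ => hdir S₀ fun i hi => hSJ (hS₀ i hi)
      rw [hinj (hSJ hi) hJ.1 h] at hi
      exact hk hi

theorem expSum_sumElim {ι κ : Type*} (z : ι → ℂ) (z' : κ → ℂ) (S : Finset (ι ⊕ κ))
    (x : ι ⊕ κ → ℂ) (s : ℝ) :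
    expSum (Sum.elim z z') S x s
      = expSum z S.toLeft (fun i => x (Sum.inl i)) s
        + expSum z' S.toRight (fun i => x (Sum.inr i)) s := by
  simp only [expSum]
  rw [Finset.sum_sum_eq_sum_toLeft_add_sum_toRight]
  rfl

theorem finite_int_abs_le (R : ℝ) : {n : ℤ | |(n : ℝ)| ≤ R}.Finite := by
  refine (Set.finite_Icc (-⌊R⌋) ⌊R⌋).subset fun n hn => ?_
  have h := abs_le.1 (show |(n : ℝ)| ≤ R from hn)
  exact ⟨neg_le.1 (Int.le_floor.2 (by push_cast; linarith)), Int.le_floor.2 h.2⟩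

theorem finite_norm_le_of_im {z : ℤ → ℂ} {u K : ℝ} (hu : 0 < u)
    (hz : ∀ n : ℤ, n ≠ 0 → |(z n).im - u * n| ≤ K) (R : ℝ) :
    {n : ℤ | n ≠ 0 ∧ ‖z n‖ ≤ R}.Finite := by
  refine (finite_int_abs_le ((R + K) / u)).subset fun n hn => ?_
  have h1 : |u * (n : ℝ)| ≤ R + K := by
    have h2 := abs_sub_abs_le_abs_sub (u * (n : ℝ)) (z n).im
    rw [abs_sub_comm] at h2
    linarith [hz n hn.1, Complex.abs_im_le_norm (z n), hn.2]
  rw [abs_mul, abs_of_pos hu] at h1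
  show |(n : ℝ)| ≤ (R + K) / u
  rwa [le_div_iff₀ hu, mul_comm]

theorem observability_of_asymptotics {zh zp : ℤ → ℂ} {ω u μ K : ℝ} (hω : 0 ≤ ω) (hu : 0 < u)
    (hμ : 0 < μ) (hK : 0 ≤ K)
    (hzh : ∀ n : ℤ, n ≠ 0 → ‖zh n - (-(ω : ℂ) + Complex.I * (u * n : ℝ))‖ ≤ K / (n : ℝ) ^ 2)
    (hreh : ∀ n : ℤ, n ≠ 0 → (zh n).re ≤ 0)
    (hzp : ∀ j : ℤ, j ≠ 0 → ‖zp j - (-(μ * (j : ℝ) ^ 2 : ℝ) + Complex.I * (u * j : ℝ))‖ ≤ K)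
    (hrep : ∀ n : ℤ, n ≠ 0 → (zp n).re ≤ 0)
    (hhh : ∀ n l : ℤ, n ≠ 0 → l ≠ 0 → zh n = zh l → n = l)
    (hpp : ∀ n l : ℤ, n ≠ 0 → l ≠ 0 → zp n = zp l → n = l)
    (hhp : ∀ n l : ℤ, n ≠ 0 → l ≠ 0 → zh n ≠ zp l)
    {T : ℝ} (hT : 2 * Real.pi / u < T) :
    ∃ C > 0, ∀ Sh Sp : Finset ℤ, (∀ n ∈ Sh, n ≠ 0) → (∀ n ∈ Sp, n ≠ 0) → ∀ A x : ℤ → ℂ,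
      ∑ n ∈ Sh, ‖A n‖ ^ 2 + ∑ n ∈ Sp, Real.exp (2 * (zp n).re * T) * ‖x n‖ ^ 2
        ≤ C * ∫ s in (0 : ℝ)..T, ‖expSum zh Sh A s + expSum zp Sp x s‖ ^ 2 := by
  have hP0 : 0 < 2 * Real.pi / u := by positivity
  set τ := (T - 2 * Real.pi / u) / 2 with hτ
  have hτ0 : 0 < τ := by rw [hτ]; linarith
  obtain ⟨N, -, C, hC, hhigh⟩ := high_frequency_observability hω hu hμ hK hzh hreh hzp
    (half_pos hτ0) (half_lt_self hτ0)
  set T₁ := τ + 2 * Real.pi / u with hT₁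
  have hT₁0 : 0 < T₁ := by linarith
  have hT₁T : T₁ < T := by linarith
  set z : ℤ ⊕ ℤ → ℂ := Sum.elim zh zp with hz
  set w : ℤ ⊕ ℤ → ℝ := Sum.elim (fun _ => 1) (fun n => Real.exp (2 * (zp n).re * (τ / 2))) with hw
  have hwsum : ∀ (S : Finset (ℤ ⊕ ℤ)) (x : ℤ ⊕ ℤ → ℂ), ∑ i ∈ S, w i * ‖x i‖ ^ 2
      = ∑ n ∈ S.toLeft, ‖x (Sum.inl n)‖ ^ 2
        + ∑ n ∈ S.toRight, Real.exp (2 * (zp n).re * (τ / 2)) * ‖x (Sum.inr n)‖ ^ 2 := by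
    intro S x
    rw [Finset.sum_sum_eq_sum_toLeft_add_sum_toRight]
    simp [hw]
  set A : Set (ℤ ⊕ ℤ) := {i | Sum.elim (· ≠ 0) (· ≠ 0) i} with hA
  set S : Set (ℤ ⊕ ℤ) := {i | i ∈ A ∧ Sum.elim (fun n : ℤ => N < |(n : ℝ)|)
    (fun n : ℤ => N < |(n : ℝ)|) i} with hS
  have hobs : IsObservable z w S T₁ := by
    refine ⟨C, hC, fun S₀ hS₀ x => ?_⟩
    rw [hwsum]
    simp only [hz, expSum_sumElim]
    exact hhigh _ _ (fun n hn => (hS₀ _ (Finset.mem_toLeft.1 hn)).2)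
      (fun n hn => (hS₀ _ (Finset.mem_toRight.1 hn)).2) _ _
  have hfinsum : ∀ p q : ℤ → Prop, {n | p n}.Finite → {n | q n}.Finite →
      {i : ℤ ⊕ ℤ | Sum.elim p q i}.Finite := by
    intro p q hp hq
    refine ((hp.image Sum.inl).union (hq.image Sum.inr)).subset ?_
    rintro (n | n) hn
    · exact Or.inl ⟨n, hn, rfl⟩
    · exact Or.inr ⟨n, hn, rfl⟩
  have himh : ∀ n : ℤ, n ≠ 0 → |(zh n).im - u * n| ≤ K := by
    intro n hn
    have h1 := (Complex.abs_im_le_norm _).trans (hzh n hn)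
    have h2 : K / (n : ℝ) ^ 2 ≤ K := by
      refine div_le_self hK ?_
      rw [← sq_abs]
      exact one_le_pow₀ (by exact_mod_cast Int.one_le_abs hn)
    simp at h1
    linarith
  have hfin : ∀ R : ℝ, {i ∈ A | ‖z i‖ ≤ R}.Finite := by
    intro R
    refine (hfinsum _ _ (finite_norm_le_of_im hu himh R) (finite_norm_le_of_im hu
      (fun n hn => (parabolic_re_im hzp hn).2) R)).subset ?_
    rintro (n | n) hn
    · exact hn
    · exact hn
  have hJ : (A \ S).Finite := by
    refine (hfinsum _ _ (finite_int_abs_le N) (finite_int_abs_le N)).subset ?_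
    rintro (n | n) hn
    · exact not_lt.1 fun h => hn.2 ⟨hn.1, h⟩
    · exact not_lt.1 fun h => hn.2 ⟨hn.1, h⟩
  have hinj : Set.InjOn z A := by
    rintro (n | n) hn (l | l) hl h
    · exact congrArg _ (hhh n l hn hl h)
    · exact absurd h (hhp n l hn hl)
    · exact absurd h.symm (hhp l n hl hn)
    · exact congrArg _ (hpp n l hn hl h)
  have hre : ∀ i ∈ A, (z i).re ≤ 0 := by
    rintro (n | n) hn
    · exact hreh n hn
    · exact hrep n hn
  have hw0 : ∀ i, 0 ≤ w i := by
    rintro (n | n)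
    · exact zero_le_one
    · exact (Real.exp_pos _).le
  have hdir : ∀ a b : ℝ, T₁ < a → a ≤ b → ∃ D ≥ 0, ∀ S₀ : Finset (ℤ ⊕ ℤ),
      (∀ i ∈ S₀, i ∈ A) → ∀ x : ℤ ⊕ ℤ → ℂ,
      ∫ s in a..b, ‖expSum z S₀ x s‖ ^ 2 ≤ D * ∑ i ∈ S₀, w i * ‖x i‖ ^ 2 := by
    intro a b ha hab
    obtain ⟨D₁, hD₁, h1⟩ := hyperbolic_direct hω hu hzh hreh (hT₁0.trans ha).le hab
    obtain ⟨D₂, hD₂, h2⟩ := parabolic_direct hμ hK hzp (τ' := τ / 2) (a := a) (by linarith) hab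
    refine ⟨2 * D₁ + 2 * D₂, by positivity, fun S₀ hS₀ x => ?_⟩
    rw [hwsum]
    simp only [hz, expSum_sumElim]
    refine (integral_norm_add_sq_le (continuous_expSum _ _ _) (continuous_expSum _ _ _)
      hab).trans ?_
    have k1 := h1 S₀.toLeft (fun n hn => hS₀ _ (Finset.mem_toLeft.1 hn)) fun n => x (Sum.inl n)
    have k2 := h2 S₀.toRight (fun n hn => hS₀ _ (Finset.mem_toRight.1 hn)) fun n => x (Sum.inr n)
    set X := ∑ n ∈ S₀.toLeft, ‖x (Sum.inl n)‖ ^ 2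
    set Y := ∑ n ∈ S₀.toRight, Real.exp (2 * (zp n).re * (τ / 2)) * ‖x (Sum.inr n)‖ ^ 2
    have hX : 0 ≤ X := Finset.sum_nonneg fun n _ => by positivity
    have hY : 0 ≤ Y := Finset.sum_nonneg fun n _ => by positivity
    nlinarith [mul_nonneg hD₁ hY, mul_nonneg hD₂ hX]
  obtain ⟨C', hC', hall⟩ := hobs.union_finset hT₁0 (fun i hi => hi.1) hinj hre hfin hw0 hdir
    hJ.toFinset (by simp) hT₁T
  refine ⟨C', hC', fun Sh Sp hSh hSp a x => ?_⟩
  have hmem : ∀ i ∈ Sh.disjSum Sp, i ∈ S ∪ ↑hJ.toFinset := by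
    intro i hi
    have hiA : i ∈ A := by
      rcases Finset.mem_disjSum.1 hi with ⟨n, hn, rfl⟩ | ⟨n, hn, rfl⟩
      · exact hSh n hn
      · exact hSp n hn
    rw [hJ.coe_toFinset]
    by_cases h : i ∈ S
    · exact Or.inl h
    · exact Or.inr ⟨hiA, h⟩
  have hfinal := hall (Sh.disjSum Sp) hmem (Sum.elim a x)
  rw [hwsum] at hfinal
  simp only [hz, expSum_sumElim, Finset.toLeft_disjSum, Finset.toRight_disjSum, Sum.elim_inl,
    Sum.elim_inr] at hfinal
  refine le_trans ?_ hfinal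
  refine add_le_add le_rfl (Finset.sum_le_sum fun n hn =>
    mul_le_mul_of_nonneg_right (Real.exp_le_exp.2 ?_) (sq_nonneg _))
  have h1 := hrep n (hSp n hn)
  have h2 : τ / 2 ≤ T := by linarith
  nlinarith

end Iterate

section Spectrum

variable {ρ u b μ : ℝ}

theorem nuH_add_nuP (n : ℤ) :
    nuH ρ u b μ n + nuP ρ u b μ n = -((μ * (n : ℝ) ^ 2 : ℝ) : ℂ) + 2 * (Complex.I * (u * n : ℝ)) := by
  unfold nuH nuP
  split_ifs <;> push_cast <;> ring

theorem nuH_mul_nuP (n : ℤ) :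
    (nuH ρ u b μ n - Complex.I * (u * n : ℝ)) * (nuP ρ u b μ n - Complex.I * (u * n : ℝ))
      = ((b * ρ * (n : ℝ) ^ 2 : ℝ) : ℂ) := by
  unfold nuH nuP
  split_ifs with h
  · have h1 := Real.sq_sqrt (sub_nonneg.2 h)
    set s := Real.sqrt (μ ^ 2 * (n : ℝ) ^ 2 - 4 * b * ρ)
    rw [add_sub_cancel_right, add_sub_cancel_right, ← Complex.ofReal_mul]
    congr 1
    have h2 := sq_abs (n : ℝ)
    linear_combination (-(n : ℝ) ^ 2 / 4) * h1 - s ^ 2 / 4 * h2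
  · have h1 := Real.sq_sqrt (sub_nonneg.2 (not_le.1 h).le)
    set s := Real.sqrt (4 * b * ρ - μ ^ 2 * (n : ℝ) ^ 2)
    have h1' : (s : ℂ) ^ 2 = 4 * b * ρ - μ ^ 2 * (n : ℂ) ^ 2 := by exact_mod_cast h1
    push_cast
    linear_combination ((n : ℂ) ^ 2 / 4) * h1' - (n : ℂ) ^ 2 * (s : ℂ) ^ 2 / 4 * Complex.I_sq

theorem abs_mul_sqrt_le (hρ : 0 < ρ) (hb : 0 < b) (hμ : 0 < μ) (n : ℤ) :
    |(n : ℝ)| * Real.sqrt (μ ^ 2 * (n : ℝ) ^ 2 - 4 * b * ρ) ≤ μ * (n : ℝ) ^ 2 := by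
  have h : Real.sqrt (μ ^ 2 * (n : ℝ) ^ 2 - 4 * b * ρ) ≤ μ * |(n : ℝ)| := by
    rw [Real.sqrt_le_left (by positivity), mul_pow, sq_abs]
    have := mul_pos hb hρ
    linarith
  calc _ ≤ |(n : ℝ)| * (μ * |(n : ℝ)|) := by gcongr
    _ = μ * |(n : ℝ)| ^ 2 := by ring
    _ = _ := by rw [sq_abs]

theorem nuH_re_nonpos (hρ : 0 < ρ) (hb : 0 < b) (hμ : 0 < μ) (n : ℤ) :
    (nuH ρ u b μ n).re ≤ 0 := by
  have h := abs_mul_sqrt_le hρ hb hμ n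
  have h2 : 0 ≤ μ * (n : ℝ) ^ 2 := by positivity
  unfold nuH
  split_ifs <;> rw [Complex.add_re, Complex.ofReal_re, Complex.re_mul_ofReal, Complex.I_re] <;>
    linarith

theorem nuP_re_le (n : ℤ) : (nuP ρ u b μ n).re ≤ -(μ * (n : ℝ) ^ 2 / 2) := by
  unfold nuP
  split_ifs <;> rw [Complex.add_re, Complex.ofReal_re, Complex.re_mul_ofReal, Complex.I_re]
  · have := mul_nonneg (abs_nonneg (n : ℝ)) (Real.sqrt_nonneg (μ ^ 2 * (n : ℝ) ^ 2 - 4 * b * ρ))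
    linarith
  · linarith

theorem norm_nuH_sub_le (hρ : 0 < ρ) (hb : 0 < b) (hμ : 0 < μ) {n : ℤ} (hn : n ≠ 0) :
    ‖nuH ρ u b μ n - Complex.I * (u * n : ℝ)‖ ≤ 2 * (b * ρ / μ) := by
  have hn2 : 0 < (n : ℝ) ^ 2 := by positivity
  have hbρ := mul_pos hb hρ
  have hprod := congrArg norm (nuH_mul_nuP (ρ := ρ) (u := u) (b := b) (μ := μ) n)
  rw [norm_mul, Complex.norm_real, Real.norm_of_nonneg (by positivity)] at hprod
  by_cases h : 4 * b * ρ ≤ μ ^ 2 * (n : ℝ) ^ 2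
  · have h1 : μ * (n : ℝ) ^ 2 / 2 ≤ ‖nuP ρ u b μ n - Complex.I * (u * n : ℝ)‖ := by
      refine le_trans ?_ (Complex.abs_re_le_norm _)
      rw [Complex.sub_re, Complex.re_mul_ofReal, Complex.I_re, zero_mul, sub_zero]
      refine le_trans ?_ (neg_le_abs _)
      linarith [nuP_re_le (ρ := ρ) (u := u) (b := b) (μ := μ) n]
    have h2 := mul_le_mul_of_nonneg_left h1 (norm_nonneg (nuH ρ u b μ n - Complex.I * (u * n : ℝ)))
    rw [hprod] at h2
    rw [← mul_div_assoc, le_div_iff₀ hμ]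
    nlinarith
  · have h1 : nuP ρ u b μ n - Complex.I * (u * n : ℝ)
        = (starRingEnd ℂ) (nuH ρ u b μ n - Complex.I * (u * n : ℝ)) := by
      unfold nuH nuP
      rw [if_neg h, if_neg h]
      simp only [map_sub, map_add, map_mul, Complex.conj_ofReal, Complex.conj_I]
      push_cast
      ring
    rw [h1, Complex.norm_conj, ← sq] at hprod
    refine abs_le_of_sq_le_sq' ?_ (by positivity) |>.2
    rw [hprod, mul_pow, div_pow, ← mul_div_assoc, le_div_iff₀ (by positivity)]
    nlinarith [not_le.1 h]

theorem norm_nuH_sub_asymptotic_le (hρ : 0 < ρ) (hb : 0 < b) (hμ : 0 < μ) {n : ℤ} (hn : n ≠ 0) :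
    ‖nuH ρ u b μ n - (-((b * ρ / μ : ℝ) : ℂ) + Complex.I * (u * n : ℝ))‖
      ≤ (2 * (b * ρ / μ)) ^ 2 / μ / (n : ℝ) ^ 2 := by
  have h1 := nuH_mul_nuP (ρ := ρ) (u := u) (b := b) (μ := μ) n
  have h2 := nuH_add_nuP (ρ := ρ) (u := u) (b := b) (μ := μ) n
  have h3 := norm_nuH_sub_le (u := u) hρ hb hμ hn
  set v := nuH ρ u b μ n - Complex.I * (u * n : ℝ) with hv
  have hμ' : (μ : ℂ) ≠ 0 := by exact_mod_cast hμ.ne'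
  have h4 : ((μ * (n : ℝ) ^ 2 : ℝ) : ℂ)
      * (nuH ρ u b μ n - (-((b * ρ / μ : ℝ) : ℂ) + Complex.I * (u * n : ℝ))) = -v ^ 2 := by
    have e : nuP ρ u b μ n - Complex.I * (u * n : ℝ) = -((μ * (n : ℝ) ^ 2 : ℝ) : ℂ) - v := by
      linear_combination h2
    have e' : ((μ * (n : ℝ) ^ 2 : ℝ) : ℂ) * ((b * ρ / μ : ℝ) : ℂ)
        = ((b * ρ * (n : ℝ) ^ 2 : ℝ) : ℂ) := by
      push_cast
      field_simp
    rw [e] at h1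
    linear_combination e' - h1
  have h5 := congrArg norm h4
  rw [norm_mul, norm_neg, norm_pow, Complex.norm_real, Real.norm_of_nonneg (by positivity)] at h5
  have hn2 : 0 < (n : ℝ) ^ 2 := by positivity
  rw [div_div, le_div_iff₀ (by positivity), mul_comm, h5]
  gcongr

theorem norm_nuP_sub_asymptotic_le (hρ : 0 < ρ) (hb : 0 < b) (hμ : 0 < μ) {n : ℤ} (hn : n ≠ 0) :
    ‖nuP ρ u b μ n - (-((μ * (n : ℝ) ^ 2 : ℝ) : ℂ) + Complex.I * (u * n : ℝ))‖
      ≤ 2 * (b * ρ / μ) := by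
  have e : nuP ρ u b μ n - (-((μ * (n : ℝ) ^ 2 : ℝ) : ℂ) + Complex.I * (u * n : ℝ))
      = -(nuH ρ u b μ n - Complex.I * (u * n : ℝ)) := by
    linear_combination nuH_add_nuP (ρ := ρ) (u := u) (b := b) (μ := μ) n
  rw [e, norm_neg]
  exact norm_nuH_sub_le hρ hb hμ hn

theorem le_norm_nuH_sub (hρ : 0 < ρ) (hb : 0 < b) (hμ : 0 < μ) {n : ℤ} (hn : n ≠ 0) :
    b * ρ / (μ + 2 * (b * ρ / μ)) ≤ ‖nuH ρ u b μ n - Complex.I * (u * n : ℝ)‖ := by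
  have hprod := congrArg norm (nuH_mul_nuP (ρ := ρ) (u := u) (b := b) (μ := μ) n)
  rw [norm_mul, Complex.norm_real, Real.norm_of_nonneg (by positivity)] at hprod
  have hn2 : 0 < (n : ℝ) ^ 2 := by positivity
  have hn1 : 1 ≤ (n : ℝ) ^ 2 := by
    rw [← sq_abs]
    exact one_le_pow₀ (by exact_mod_cast Int.one_le_abs hn)
  have hω : 0 < b * ρ / μ := by positivity
  have h1 : ‖nuP ρ u b μ n - Complex.I * (u * n : ℝ)‖ ≤ (μ + 2 * (b * ρ / μ)) * (n : ℝ) ^ 2 := by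
    have h2 := norm_nuP_sub_asymptotic_le (u := u) hρ hb hμ hn
    have e : nuP ρ u b μ n - Complex.I * (u * n : ℝ)
        = (nuP ρ u b μ n - (-((μ * (n : ℝ) ^ 2 : ℝ) : ℂ) + Complex.I * (u * n : ℝ)))
          - ((μ * (n : ℝ) ^ 2 : ℝ) : ℂ) := by ring
    rw [e]
    refine (norm_sub_le _ _).trans ?_
    rw [Complex.norm_real, Real.norm_of_nonneg (by positivity)]
    nlinarith
  have h3 := mul_le_mul_of_nonneg_left h1 (norm_nonneg (nuH ρ u b μ n - Complex.I * (u * n : ℝ)))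
  rw [hprod, ← mul_assoc] at h3
  rw [div_le_iff₀ (by positivity)]
  exact le_of_mul_le_mul_right h3 hn2

theorem le_norm_nuH (hu : 0 < u) (hμ : 0 < μ) {n : ℤ} (hn : n ≠ 0) :
    min u (μ / 2) * |(n : ℝ)| ≤ ‖nuH ρ u b μ n‖ := by
  have hn1 : (1 : ℝ) ≤ |(n : ℝ)| := by exact_mod_cast Int.one_le_abs hn
  by_cases h : 4 * b * ρ ≤ μ ^ 2 * (n : ℝ) ^ 2
  · have him : (nuH ρ u b μ n).im = u * n := by
      unfold nuH
      rw [if_pos h, Complex.add_im, Complex.ofReal_im, Complex.im_mul_ofReal, Complex.I_im]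
      ring
    refine le_trans ?_ (Complex.abs_im_le_norm _)
    rw [him, abs_mul, abs_of_pos hu]
    gcongr
    exact min_le_left _ _
  · have hre : (nuH ρ u b μ n).re = -(μ * (n : ℝ) ^ 2) / 2 := by
      unfold nuH
      rw [if_neg h, Complex.add_re, Complex.ofReal_re, Complex.re_mul_ofReal, Complex.I_re]
      ring
    refine le_trans ?_ (Complex.abs_re_le_norm _)
    rw [hre, neg_div, abs_neg, abs_of_nonneg (a := μ * (n : ℝ) ^ 2 / 2) (by positivity), ← sq_abs]
    calc min u (μ / 2) * |(n : ℝ)| ≤ μ / 2 * |(n : ℝ)| := by gcongr; exact min_le_right _ _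
      _ ≤ μ / 2 * (|(n : ℝ)| * |(n : ℝ)|) := by
        gcongr
        exact le_mul_of_one_le_left (abs_nonneg _) hn1
      _ = _ := by ring

theorem exists_le_norm_nu2_mul (hρ : 0 < ρ) (hu : 0 < u) (hb : 0 < b) (hμ : 0 < μ) :
    ∃ m > 0, ∀ n : ℤ, n ≠ 0 →
      m / |(n : ℝ)| ≤ ‖nu2 ρ u b μ n * (nu2 ρ u b μ n - (u : ℂ))‖ := by
  refine ⟨min u (μ / 2) * (b * ρ / (μ + 2 * (b * ρ / μ))), by positivity, fun n hn => ?_⟩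
  have hn' : (n : ℂ) ≠ 0 := by exact_mod_cast hn
  have e : nu2 ρ u b μ n * (nu2 ρ u b μ n - (u : ℂ))
      = nuH ρ u b μ n * (nuH ρ u b μ n - Complex.I * (u * n : ℝ)) / (Complex.I * n) ^ 2 := by
    unfold nu2
    have := Complex.I_ne_zero
    push_cast
    field_simp
  have hn0 : 0 < |(n : ℝ)| := by positivity
  have hw : ‖(n : ℂ)‖ = |(n : ℝ)| := Complex.norm_intCast n
  rw [e, norm_div, norm_mul, norm_pow, norm_mul, Complex.norm_I, one_mul, hw,
    div_le_div_iff₀ hn0 (by positivity)]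
  calc min u (μ / 2) * (b * ρ / (μ + 2 * (b * ρ / μ))) * |(n : ℝ)| ^ 2
      = (min u (μ / 2) * |(n : ℝ)|) * (b * ρ / (μ + 2 * (b * ρ / μ))) * |(n : ℝ)| := by ring
    _ ≤ _ := by
      gcongr
      · exact le_norm_nuH hu hμ hn
      · exact le_norm_nuH_sub hρ hb hμ hn

theorem le_norm_nu1 (hμ : 0 < μ) {n : ℤ} (hn : n ≠ 0) : μ / 2 ≤ ‖nu1 ρ u b μ n‖ := by
  have hn1 : (1 : ℝ) ≤ |(n : ℝ)| := by exact_mod_cast Int.one_le_abs hn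
  have hw : ‖(n : ℂ)‖ = |(n : ℝ)| := Complex.norm_intCast n
  rw [nu1, norm_div, norm_mul, Complex.norm_I, one_mul, hw, le_div_iff₀ (by positivity)]
  refine le_trans ?_ (Complex.abs_re_le_norm _)
  refine le_trans ?_ (neg_le_abs _)
  have h1 := nuP_re_le (ρ := ρ) (u := u) (b := b) (μ := μ) n
  rw [← sq_abs] at h1
  have h2 : |(n : ℝ)| ≤ |(n : ℝ)| ^ 2 := by nlinarith
  nlinarith

end Spectrum

/-- Observability inequality for boundary control in velocity at large time
`T > 2π/ū`, written in the Riesz basis of eigenfunctions of the adjoint operator,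
assuming all eigenvalues `ν_n^h, ν_n^p` (for nonzero `n`) are pairwise distinct. -/
theorem observability_velocity (ρ u b μ : ℝ) (hρ : 0 < ρ) (hu : 0 < u) (hb : 0 < b)
    (hμ : 0 < μ)
    (hdist₁ : ∀ n l : ℤ, n ≠ 0 → l ≠ 0 → nuH ρ u b μ n = nuH ρ u b μ l → n = l)
    (hdist₂ : ∀ n l : ℤ, n ≠ 0 → l ≠ 0 → nuP ρ u b μ n = nuP ρ u b μ l → n = l)
    (hdist₃ : ∀ n l : ℤ, n ≠ 0 → l ≠ 0 → nuH ρ u b μ n ≠ nuP ρ u b μ l)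
    (T : ℝ) (hT : 2 * Real.pi / u < T) :
    ∃ C > 0, ∀ a c : ℤ → ℂ,
      (Function.support a).Finite → (Function.support c).Finite → a 0 = 0 → c 0 = 0 →
      (∑' n : ℤ, ‖a n‖ ^ 2 / (n : ℝ) ^ 2)
        + (∑' n : ℤ, ‖c n‖ ^ 2 * Real.exp (2 * (nuP ρ u b μ n).re * T)) ≤
      C * ∫ t in (0 : ℝ)..T,
        ‖(∑' n : ℤ, a n * (nu2 ρ u b μ n * (nu2 ρ u b μ n - (u : ℂ)))
            * Complex.exp (nuH ρ u b μ n * ((T : ℂ) - (t : ℂ))))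
          + ∑' n : ℤ, c n * nu1 ρ u b μ n
            * Complex.exp (nuP ρ u b μ n * ((T : ℂ) - (t : ℂ)))‖ ^ 2 := by
  have hω : 0 < b * ρ / μ := by positivity
  set K := max ((2 * (b * ρ / μ)) ^ 2 / μ) (2 * (b * ρ / μ)) with hK
  obtain ⟨C, hC, hmain⟩ := observability_of_asymptotics (zh := nuH ρ u b μ) (zp := nuP ρ u b μ)
    (K := K) hω.le hu hμ (le_max_of_le_right (by positivity))
    (fun n hn => (norm_nuH_sub_asymptotic_le hρ hb hμ hn).trans (by
      gcongr
      exact le_max_left _ _))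
    (fun n _ => nuH_re_nonpos hρ hb hμ n)
    (fun n hn => (norm_nuP_sub_asymptotic_le hρ hb hμ hn).trans (le_max_right _ _))
    (fun n _ => (nuP_re_le n).trans (neg_nonpos.2 (by positivity)))
    hdist₁ hdist₂ hdist₃ hT
  obtain ⟨m, hm, hnu2⟩ := exists_le_norm_nu2_mul hρ hu hb hμ
  refine ⟨(1 / m ^ 2 + 1 / (μ / 2) ^ 2) * C, by positivity, fun a c ha hc ha0 hc0 => ?_⟩
  have haS : ∀ n ∉ ha.toFinset, a n = 0 := fun n hn => by simpa using hn
  have hcS : ∀ n ∉ hc.toFinset, c n = 0 := fun n hn => by simpa using hn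
  have ha' : ∀ n ∈ ha.toFinset, n ≠ 0 := by
    rintro n hn rfl
    simp [ha0] at hn
  have hc' : ∀ n ∈ hc.toFinset, n ≠ 0 := by
    rintro n hn rfl
    simp [hc0] at hn
  set A : ℤ → ℂ := fun n => a n * (nu2 ρ u b μ n * (nu2 ρ u b μ n - (u : ℂ)))
  set X : ℤ → ℂ := fun n => c n * nu1 ρ u b μ n
  have hsum : ∀ t : ℝ, (∑' n : ℤ, a n * (nu2 ρ u b μ n * (nu2 ρ u b μ n - (u : ℂ)))
            * Complex.exp (nuH ρ u b μ n * ((T : ℂ) - (t : ℂ))))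
          + ∑' n : ℤ, c n * nu1 ρ u b μ n * Complex.exp (nuP ρ u b μ n * ((T : ℂ) - (t : ℂ)))
      = expSum (nuH ρ u b μ) ha.toFinset A (T - t)
        + expSum (nuP ρ u b μ) hc.toFinset X (T - t) := by
    intro t
    rw [tsum_eq_sum (s := ha.toFinset) fun n hn => by rw [haS n hn]; ring,
      tsum_eq_sum (s := hc.toFinset) fun n hn => by rw [hcS n hn]; ring]
    simp only [expSum, A, X, Complex.ofReal_sub]
  simp only [hsum]
  rw [intervalIntegral.integral_comp_sub_left (fun s => ‖expSum (nuH ρ u b μ) ha.toFinset A s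
      + expSum (nuP ρ u b μ) hc.toFinset X s‖ ^ 2) T, sub_self, sub_zero,
    tsum_eq_sum (s := ha.toFinset) fun n hn => by simp [haS n hn],
    tsum_eq_sum (s := hc.toFinset) fun n hn => by simp [hcS n hn], mul_assoc]
  refine le_trans ?_ (mul_le_mul_of_nonneg_left (hmain _ _ ha' hc' A X) (by positivity))
  have hA : ∑ n ∈ ha.toFinset, ‖a n‖ ^ 2 / (n : ℝ) ^ 2
      ≤ 1 / m ^ 2 * ∑ n ∈ ha.toFinset, ‖A n‖ ^ 2 := by
    rw [Finset.mul_sum]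
    refine Finset.sum_le_sum fun n hn => ?_
    have hn0 := ha' n hn
    have hn1 : 0 < |(n : ℝ)| := by positivity
    rw [norm_mul, ← sq_abs (n : ℝ)]
    calc ‖a n‖ ^ 2 / |(n : ℝ)| ^ 2 = 1 / m ^ 2 * (‖a n‖ * (m / |(n : ℝ)|)) ^ 2 := by field_simp
      _ ≤ _ := by
        have := hnu2 n hn0
        gcongr
  have hX : ∑ n ∈ hc.toFinset, ‖c n‖ ^ 2 * Real.exp (2 * (nuP ρ u b μ n).re * T)
      ≤ 1 / (μ / 2) ^ 2
        * ∑ n ∈ hc.toFinset, Real.exp (2 * (nuP ρ u b μ n).re * T) * ‖X n‖ ^ 2 := by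
    rw [Finset.mul_sum]
    refine Finset.sum_le_sum fun n hn => ?_
    rw [norm_mul]
    calc ‖c n‖ ^ 2 * Real.exp (2 * (nuP ρ u b μ n).re * T)
        = 1 / (μ / 2) ^ 2 * (Real.exp (2 * (nuP ρ u b μ n).re * T) * (‖c n‖ * (μ / 2)) ^ 2) := by
          field_simp
      _ ≤ _ := by
        have := le_norm_nu1 (ρ := ρ) (u := u) (b := b) hμ (hc' n hn)
        gcongr
  rw [add_mul, mul_add, mul_add]
  have h1 : 0 ≤ ∑ n ∈ ha.toFinset, ‖A n‖ ^ 2 := Finset.sum_nonneg fun n _ => by positivity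
  have h2 : 0 ≤ ∑ n ∈ hc.toFinset, Real.exp (2 * (nuP ρ u b μ n).re * T) * ‖X n‖ ^ 2 :=
    Finset.sum_nonneg fun n _ => by positivity
  have h3 : 0 ≤ 1 / m ^ 2 := by positivity
  have h4 : 0 ≤ 1 / (μ / 2) ^ 2 := by positivity
  linarith [mul_nonneg h3 h2, mul_nonneg h4 h1]
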